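/- arXiv:2411.13967 — 2 statements merged into one kernel-verified Lean document; each statement's English description precedes it below -/
import Mathlib

section
/- Let n ≥ 2 be an integer and p a prime number. Then p is a bad prime for n (i.e., there exist an algebraically closed field K of characteristic p and a monic Casas–Alvero polynomial f ∈ K[x] of degree n that is not of the form (x−b)^n for any b ∈ K) if and only if there exists a tuple T = (j_1,…,j_{n−1}) ∈ {1,…,n}^{n−1} such that p divides the integer J_T, the greatest common divisor of all C×C minors of the integer matrix M_T. -/
open Polynomial MvPolynomial

/-- `f` is a Casas–Alvero polynomial of degree `n`: it is monic of degree `n` and for each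
`i ∈ {1, …, n-1}` it has a nonconstant common factor with its `i`-th Hasse derivative. -/
def IsCasasAlvero {K : Type} [Field K] (n : ℕ) (f : K[X]) : Prop :=
  f.Monic ∧ f.natDegree = n ∧
    ∀ i ∈ Finset.Ioo 0 n,
      ∃ g : K[X], 0 < g.degree ∧ g ∣ f ∧ g ∣ Polynomial.hasseDeriv i f

/-- `p` is a bad prime for `n`: `p` is prime and there are an algebraically closed field `K` of
characteristic `p` and a Casas–Alvero polynomial of degree `n` over `K` which is not an `n`-th
power of a linear polynomial. -/
def IsBadPrime (n p : ℕ) : Prop :=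
  p.Prime ∧ ∃ (K : Type) (_ : Field K), IsAlgClosed K ∧ CharP K p ∧
    ∃ f : K[X], IsCasasAlvero n f ∧ ¬ ∃ b : K, f = (Polynomial.X - Polynomial.C b) ^ n

/-- The involution `Φ_j` on `K[x_1,…,x_m]`, sending `x_i ↦ x_i - x_j` for `i ≠ j` and
`x_j ↦ -x_j`. -/
noncomputable def Phi (K : Type) [CommRing K] {m : ℕ} (j : Fin m) :
    MvPolynomial (Fin m) K →ₐ[K] MvPolynomial (Fin m) K :=
  MvPolynomial.aeval fun i =>
    if i = j then -MvPolynomial.X j else MvPolynomial.X i - MvPolynomial.X j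

/-- `Φ_j` for `j ∈ {1,…,n}` acting on `K[x_1,…,x_{n-1}]`; for `j = n` (the last index of `Fin n`)
this is the identity. -/
noncomputable def PhiFull (K : Type) [CommRing K] (n : ℕ) (j : Fin n) :
    MvPolynomial (Fin (n - 1)) K →ₐ[K] MvPolynomial (Fin (n - 1)) K :=
  if h : (j : ℕ) < n - 1 then Phi K ⟨j, h⟩ else AlgHom.id K _

/-- `G_{T,i} = Φ_{j_i}(σ_i)`, where `i` ranges over `Fin (n-1)` (representing the degree `i+1`). -/
noncomputable def G (K : Type) [CommRing K] (n : ℕ) (T : Fin (n - 1) → Fin n)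
    (i : Fin (n - 1)) : MvPolynomial (Fin (n - 1)) K :=
  PhiFull K n (T i) (MvPolynomial.esymm (Fin (n - 1)) K ((i : ℕ) + 1))

/-- `d = (n² - 3n + 4)/2`. -/
def casasD (n : ℕ) : ℕ := (n ^ 2 - 3 * n + 4) / 2

/-- `C = binom((n²-n)/2, n-2)`, the number of monomials of degree `d` in `n-1` variables. -/
def casasC (n : ℕ) : ℕ := Nat.choose ((n ^ 2 - n) / 2) (n - 2)

/-- `D = Σ_{i=1}^{n-1} binom(d-i+n-2, n-2)`, the number of rows of `M_T`. -/
def casasDD (n : ℕ) : ℕ :=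
  ∑ i ∈ Finset.Icc 1 (n - 1), Nat.choose (casasD n - i + n - 2) (n - 2)

/-- The matrix `M_T` over `ℤ`, whose rows, indexed by pairs `(i, α)` with `|α| = d - i`, are the
coefficient vectors of `x^α · G_{T,i}` with respect to the monomials of degree `d`
(a monomial of degree `e` in `n-1` variables is encoded as an element of `Sym (Fin (n-1)) e`). -/
noncomputable def casasM (n : ℕ) (T : Fin (n - 1) → Fin n) :
    Matrix ((i : Fin (n - 1)) × Sym (Fin (n - 1)) (casasD n - ((i : ℕ) + 1)))
      (Sym (Fin (n - 1)) (casasD n)) ℤ :=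
  fun r c =>
    MvPolynomial.coeff (Multiset.toFinsupp (c : Multiset (Fin (n - 1))))
      (MvPolynomial.monomial (Multiset.toFinsupp (r.2 : Multiset (Fin (n - 1)))) 1 * G ℤ n T r.1)

/-- `J_T`: the greatest common divisor of all `C × C` minors of `M_T`. -/
noncomputable def casasJ (n : ℕ) (T : Fin (n - 1) → Fin n) : ℤ :=
  Finset.gcd (Finset.univ.filter fun
      f : Sym (Fin (n - 1)) (casasD n) →
        (i : Fin (n - 1)) × Sym (Fin (n - 1)) (casasD n - ((i : ℕ) + 1)) =>
      Function.Injective f)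
    fun f => ((casasM n T).submatrix f id).det

/-- The upper bound `C! · ∏_{i=1}^{n-1} binom(i+n-2, n-2)^binom(d-i+n-2, n-2)`. -/
def casasBound (n : ℕ) : ℕ :=
  (casasC n).factorial * ∏ i ∈ Finset.Icc 1 (n - 1),
    Nat.choose (i + n - 2) (n - 2) ^ Nat.choose (casasD n - i + n - 2) (n - 2)

namespace CasasAux

variable {K : Type} [Field K]

attribute [local instance] MvPolynomial.gradedAlgebra

lemma aeval_eval {σ : Type} (x : σ → K) (f : MvPolynomial σ K) :
    MvPolynomial.aeval x f = MvPolynomial.eval x f := by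
  rw [← MvPolynomial.coe_aeval_eq_eval]; rfl

lemma eval_smul_homog {σ : Type} {f : MvPolynomial σ K} {e : ℕ} (hf : f.IsHomogeneous e) (t : K)
    (x : σ → K) : MvPolynomial.eval (t • x) f = t ^ e * MvPolynomial.eval x f := by
  rw [MvPolynomial.eval_eq, MvPolynomial.eval_eq, Finset.mul_sum]
  refine Finset.sum_congr rfl fun d hd => ?_
  have h1 : ∑ i ∈ d.support, d i = e := (hf.degree_eq_sum_deg_support hd).symm
  have h2 : ∏ i ∈ d.support, (t • x) i ^ d i = t ^ e * ∏ i ∈ d.support, x i ^ d i := by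
    simp only [Pi.smul_apply, smul_eq_mul, mul_pow, Finset.prod_mul_distrib,
      Finset.prod_pow_eq_pow_sum, h1]
  rw [h2]; ring

lemma hc_mul {σ : Type} {d : ℕ} {F : MvPolynomial σ K} (hF : F.IsHomogeneous d)
    (g : MvPolynomial σ K) (e : ℕ) :
    homogeneousComponent (d + e) (F * g) = F * homogeneousComponent e g := by
  have h := DirectSum.coe_decompose_mul_add_of_left_mem (homogeneousSubmodule σ K) (i := d) (j := e)
    (a := F) (b := g) hF
  have h2 : ∀ (i : ℕ) (φ : MvPolynomial σ K),
      (DirectSum.decompose (homogeneousSubmodule σ K) φ i : MvPolynomial σ K)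
        = homogeneousComponent i φ := fun i φ => decomposition.decompose'_apply φ i
  rwa [h2, h2] at h

lemma hc_mul_of_lt {σ : Type} {d : ℕ} {F : MvPolynomial σ K} (hF : F.IsHomogeneous d)
    (g : MvPolynomial σ K) {e : ℕ} (he : e < d) :
    homogeneousComponent e (F * g) = 0 := by
  have h := DirectSum.coe_decompose_mul_of_left_mem_of_not_le (homogeneousSubmodule σ K)
    (i := d) (n := e) (a := F) (b := g) hF (by omega)
  have h2 : ∀ (i : ℕ) (φ : MvPolynomial σ K),
      (DirectSum.decompose (homogeneousSubmodule σ K) φ i : MvPolynomial σ K)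
        = homogeneousComponent i φ := fun i φ => decomposition.decompose'_apply φ i
  rwa [h2] at h

lemma homog_span {σ ι : Type} (F : ι → MvPolynomial σ K) (d : ι → ℕ)
    (hF : ∀ i, (F i).IsHomogeneous (d i)) (s : Set ι) :
    (Ideal.span (F '' s)).IsHomogeneous (homogeneousSubmodule σ K) := by
  apply Ideal.homogeneous_span
  rintro _ ⟨i, _, rfl⟩
  exact ⟨d i, hF i⟩

/-- graded Nakayama lemma -/
lemma nak {σ : Type} {I N : Ideal (MvPolynomial σ K)}
    (hI : I.IsHomogeneous (homogeneousSubmodule σ K)) {l : MvPolynomial σ K}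
    (hl : l.IsHomogeneous 1)
    (h : ∀ z ∈ N, ∃ i ∈ I, ∃ w ∈ N, z = i + l * w) : N ≤ I := by
  have key : ∀ k : ℕ, ∀ z ∈ N, ∃ i ∈ I, ∃ w ∈ N, z = i + l ^ k * w := by
    intro k
    induction k with
    | zero => intro z hz; exact ⟨0, I.zero_mem, z, hz, by simp⟩
    | succ k ih =>
      intro z hz
      obtain ⟨i, hi, w, hw, rfl⟩ := ih z hz
      obtain ⟨i', hi', w', hw', rfl⟩ := h w hw
      exact ⟨i + l ^ k * i', I.add_mem hi (I.mul_mem_left _ hi'), w', hw', by ring⟩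
  intro z hz
  rw [mem_iff_homogeneousComponent_mem hI]
  intro e
  obtain ⟨i, hi, w, hw, rfl⟩ := key (e + 1) z hz
  have h1 := hl.pow (e + 1)
  rw [map_add, hc_mul_of_lt h1 w (by omega), add_zero]
  exact homogeneousComponent_mem_of_mem hI hi e

/-- homogeneous lifting -/
lemma homog_lift {σ : Type} {I : Ideal (MvPolynomial σ K)}
    (hI : I.IsHomogeneous (homogeneousSubmodule σ K)) {F f : MvPolynomial σ K} {d e : ℕ}
    (hF : F.IsHomogeneous d) (hf : f.IsHomogeneous (d + e)) (h : f ∈ I ⊔ Ideal.span {F}) :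
    ∃ i ∈ I, ∃ g : MvPolynomial σ K, g.IsHomogeneous e ∧ f = i + F * g := by
  obtain ⟨i, hi, y, hy, rfl⟩ := Submodule.mem_sup.1 h
  obtain ⟨g, rfl⟩ := Ideal.mem_span_singleton'.1 hy
  refine ⟨homogeneousComponent (d + e) i, homogeneousComponent_mem_of_mem hI hi _,
    homogeneousComponent e g, homogeneousComponent_isHomogeneous _ _, ?_⟩
  rw [← hc_mul hF, ← map_add, mul_comm F g]
  exact (homogeneousComponent_eq_self hf).symm

/-- Nullstellensatz: a polynomial vanishing at 0 -/
lemma exists_pow_mem {m : ℕ} [IsAlgClosed K] (I : Ideal (MvPolynomial (Fin m) K))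
    (h : ∀ x : Fin m → K, (∀ f ∈ I, eval x f = 0) → x = 0)
    (f : MvPolynomial (Fin m) K) (hf : eval 0 f = 0) : f ∈ I.radical := by
  rw [← vanishingIdeal_zeroLocus_eq_radical (K := K)]
  rw [mem_vanishingIdeal_iff]
  intro x hx
  have : x = 0 := h x (by
    intro f hf
    have := hx f hf
    rwa [aeval_eval] at this)
  subst this
  rwa [aeval_eval]

lemma exists_degree_mem {m : ℕ} [IsAlgClosed K] (I : Ideal (MvPolynomial (Fin m) K))
    (h : ∀ x : Fin m → K, (∀ f ∈ I, eval x f = 0) → x = 0) :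
    ∃ N : ℕ, ∀ e ≥ N, ∀ f : MvPolynomial (Fin m) K, f.IsHomogeneous e → f ∈ I := by
  obtain ⟨N, hN⟩ := Ideal.exists_pow_le_of_le_radical_of_fg
    (I := Ideal.span (Set.range (MvPolynomial.X : Fin m → MvPolynomial (Fin m) K))) (J := I) (by
      rw [Ideal.span_le]
      rintro _ ⟨i, rfl⟩
      exact exists_pow_mem I h _ (by simp)) (Submodule.fg_span (Set.finite_range _))
  refine ⟨N, fun e he f hf => hN (Ideal.pow_le_pow_right he ?_)⟩
  rw [Ideal.mem_span_pow_iff_exists_isHomogeneous]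
  refine ⟨MvPolynomial.map MvPolynomial.C f, hf.map _, ?_⟩
  rw [MvPolynomial.eval_map]
  exact MvPolynomial.eval₂_eta f

/-- finitely many points -/
lemma finite_points {m : ℕ} [IsAlgClosed K] {J : Ideal (MvPolynomial (Fin m) K)}
    (hJ : J.IsHomogeneous (homogeneousSubmodule (Fin m) K))
    {F : MvPolynomial (Fin m) K} {d : ℕ} (hd : 0 < d) (hF : F.IsHomogeneous d)
    (h : ∀ x : Fin m → K, (∀ f ∈ J, eval x f = 0) → eval x F = 0 → x = 0) :
    {x : Fin m → K | (∀ f ∈ J, eval x f = 0) ∧ eval x F = 1}.Finite := by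
  obtain ⟨N, hN⟩ := exists_degree_mem (J ⊔ Ideal.span {F}) (fun x hx =>
    h x (fun f hf => hx f (Ideal.mem_sup_left hf))
      (hx F (Ideal.mem_sup_right (Ideal.mem_span_singleton_self F))))
  set J' : Ideal (MvPolynomial (Fin m) K) := J ⊔ Ideal.span {F - 1} with hJ'
  set U : Submodule K (MvPolynomial (Fin m) K) := restrictTotalDegree (Fin m) K (N + d) with hU
  have key : ∀ e : ℕ, ∀ f : MvPolynomial (Fin m) K, f.IsHomogeneous e →
      f ∈ J'.restrictScalars K ⊔ U := by
    intro e
    induction e using Nat.strong_induction_on with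
    | _ e ih =>
      intro f hf
      by_cases he : e ≤ N + d
      · apply Submodule.mem_sup_right
        rw [hU, mem_restrictTotalDegree]
        exact hf.totalDegree_le.trans he
      · obtain ⟨i, hi, g, hg, hfe⟩ := homog_lift (e := e - d) hJ hF
          (by convert hf using 1; omega) (hN e (by omega) f hf)
        have h1 := ih (e - d) (by omega) g hg
        have h2 : f = (i + (F - 1) * g) + g := by rw [hfe]; ring
        rw [h2]
        refine Submodule.add_mem _ (Submodule.mem_sup_left ?_) h1
        exact J'.add_mem (Ideal.mem_sup_left hi)
          (J'.mul_mem_right _ (Ideal.mem_sup_right (Ideal.mem_span_singleton_self _)))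
  have key2 : ∀ f : MvPolynomial (Fin m) K, f ∈ J'.restrictScalars K ⊔ U := by
    intro f
    rw [← sum_homogeneousComponent f]
    exact Submodule.sum_mem _ fun e _ => key e _ (homogeneousComponent_isHomogeneous _ _)
  have hfin : Module.Finite K (MvPolynomial (Fin m) K ⧸ J') := by
    have hUfin : Module.Finite K U := by
      rw [hU]; infer_instance
    refine Module.Finite.of_surjective
      ((Ideal.Quotient.mkₐ K J').toLinearMap ∘ₗ U.subtype) ?_
    intro y
    obtain ⟨f, rfl⟩ := Ideal.Quotient.mk_surjective y
    obtain ⟨j, hj, u, hu, rfl⟩ := Submodule.mem_sup.1 (key2 f)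
    refine ⟨⟨u, hu⟩, ?_⟩
    have : (Ideal.Quotient.mk J') j = 0 := Ideal.Quotient.eq_zero_iff_mem.2 hj
    simp [this]
  have hfin2 : Finite ((MvPolynomial (Fin m) K ⧸ J') →ₐ[K] K) :=
    (linearIndependent_toLinearMap K (MvPolynomial (Fin m) K ⧸ J') K).finite
  rw [← Set.finite_coe_iff]
  have hz : ∀ x : {x : Fin m → K | (∀ f ∈ J, eval x f = 0) ∧ eval x F = 1}, ∀ a ∈ J',
      MvPolynomial.aeval (x : Fin m → K) a = 0 := by
    rintro ⟨x, hx1, hx2⟩ a ha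
    have : J' ≤ RingHom.ker (MvPolynomial.aeval (R := K) x) := by
      rw [hJ', sup_le_iff, Ideal.span_singleton_le_iff_mem]
      refine ⟨fun f hf => ?_, ?_⟩
      · rw [RingHom.mem_ker, aeval_eval]; exact hx1 f hf
      · rw [RingHom.mem_ker, aeval_eval]; simp [hx2]
    exact this ha
  refine Finite.of_injective (fun x => Ideal.Quotient.liftₐ J'
    (MvPolynomial.aeval (R := K) (x : Fin m → K)) (hz x)) ?_
  intro x y hxy
  ext i
  have := DFunLike.congr_fun hxy (Ideal.Quotient.mk J' (MvPolynomial.X i))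
  simpa using this

/-- a linear form which does not vanish on the cone -/
lemma exists_linear {m : ℕ} [IsAlgClosed K] {J : Ideal (MvPolynomial (Fin (m + 1)) K)}
    (hJ : J.IsHomogeneous (homogeneousSubmodule (Fin (m + 1)) K))
    {F : MvPolynomial (Fin (m + 1)) K} {d : ℕ} (hd : 0 < d) (hF : F.IsHomogeneous d)
    (h : ∀ x : Fin (m + 1) → K, (∀ f ∈ J, eval x f = 0) → eval x F = 0 → x = 0) :
    ∃ c : Fin (m + 1) → K, c ≠ 0 ∧ ∀ x : Fin (m + 1) → K, (∀ f ∈ J, eval x f = 0) →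
      ∑ i, c i * x i = 0 → x = 0 := by
  have hfin := finite_points hJ hd hF h
  set Z := {x : Fin (m + 1) → K | (∀ f ∈ J, eval x f = 0) ∧ eval x F = 1} with hZ
  have : Finite Z := hfin
  have hF0 : eval (0 : Fin (m + 1) → K) F = 0 := by
    rw [MvPolynomial.eval_zero, constantCoeff_eq]
    exact hF.coeff_eq_zero (by simp; omega)
  obtain ⟨φ, hφ⟩ := Module.exists_dual_forall_apply_ne_zero (K := K) (M := Fin (m + 1) → K)
    (ι := Option Z) (fun o => o.elim (Pi.single 0 1) (fun z => z)) (by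
      rintro (_ | ⟨z, hz⟩)
      · simp
      · intro h0
        simp only [Option.elim] at h0
        rw [h0] at hz
        have := hz.2
        rw [hF0] at this
        exact zero_ne_one this)
  have hφs : ∀ x : Fin (m + 1) → K, φ x = ∑ i, φ (Pi.single i 1) * x i := by
    intro x
    rw [LinearMap.pi_apply_eq_sum_univ φ x]
    refine Finset.sum_congr rfl fun i _ => ?_
    rw [smul_eq_mul, mul_comm]
    congr 2
    ext j; simp [Pi.single_apply, eq_comm]
  refine ⟨fun i => φ (Pi.single i 1), ?_, ?_⟩
  · intro h0
    exact hφ none (congrFun h0 0)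
  · intro x hx hs
    rw [← hφs] at hs
    by_contra hx0
    have hFx : eval x F ≠ 0 := fun h0 => hx0 (h x hx h0)
    obtain ⟨t, ht⟩ := IsAlgClosed.exists_pow_nat_eq (eval x F)⁻¹ hd
    have hev : ∀ (f : MvPolynomial (Fin (m + 1)) K) (e : ℕ), f.IsHomogeneous e →
        eval (t • x) f = t ^ e * eval x f := by
      intro f e hf
      exact eval_smul_homog hf t x
    have hmem : t • x ∈ Z := by
      refine ⟨?_, ?_⟩
      · intro f hf
        rw [← sum_homogeneousComponent f, map_sum]
        refine Finset.sum_eq_zero fun e _ => ?_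
        rw [hev _ e (homogeneousComponent_isHomogeneous _ _),
          hx _ (homogeneousComponent_mem_of_mem hJ hf e), mul_zero]
      · rw [hev _ d hF, ht, inv_mul_cancel₀ hFx]
    apply hφ (some ⟨t • x, hmem⟩)
    simp [hs]


noncomputable def lin {m : ℕ} (c : Fin m → K) : MvPolynomial (Fin m) K :=
  ∑ i, MvPolynomial.C (c i) * MvPolynomial.X i

lemma lin_homog {m : ℕ} (c : Fin m → K) : (lin c).IsHomogeneous 1 :=
  MvPolynomial.IsHomogeneous.sum _ _ _ fun _ _ => isHomogeneous_C_mul_X _ _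

lemma lin_eval {m : ℕ} (c x : Fin m → K) :
    MvPolynomial.eval x (lin c) = ∑ i, c i * x i := by
  simp [lin]

lemma lin_ne {m : ℕ} {c : Fin m → K} (hc : c ≠ 0) : lin c ≠ 0 := by
  obtain ⟨r, hr⟩ := Function.ne_iff.1 hc
  intro h
  have := lin_eval c (Pi.single r 1)
  rw [h] at this
  simp [Pi.single_apply] at this
  exact hr this.symm

/-- restriction to a hyperplane -/
lemma exists_restrict {m : ℕ} {c : Fin (m + 1) → K} (hc : c ≠ 0) :
    ∃ ψ : MvPolynomial (Fin (m + 1)) K →ₐ[K] MvPolynomial (Fin m) K,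
      Function.Surjective ψ ∧ RingHom.ker ψ = Ideal.span {lin c} ∧
      (∀ f e, f.IsHomogeneous e → (ψ f).IsHomogeneous e) ∧
      (∀ y : Fin m → K, ∃ x : Fin (m + 1) → K,
        (∀ f, MvPolynomial.eval x f = MvPolynomial.eval y (ψ f)) ∧ (x = 0 → y = 0)) := by
  obtain ⟨r, hr⟩ := Function.ne_iff.1 hc
  simp only [Pi.zero_apply] at hr
  set a : MvPolynomial (Fin m) K := MvPolynomial.C (-(c r)⁻¹) * lin (fun j => c (r.succAbove j))
    with ha
  set v : Fin (m + 1) → MvPolynomial (Fin m) K :=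
    r.insertNth (α := fun _ => MvPolynomial (Fin m) K) a MvPolynomial.X with hv
  have hvr : v r = a := by simp [hv]
  have hvs : ∀ j, v (r.succAbove j) = MvPolynomial.X j := by intro j; simp [hv]
  set ψ : MvPolynomial (Fin (m + 1)) K →ₐ[K] MvPolynomial (Fin m) K := MvPolynomial.aeval v with hψ
  have hψX : ∀ i, ψ (MvPolynomial.X i) = v i := fun i => MvPolynomial.aeval_X _ _
  set ι : MvPolynomial (Fin m) K →ₐ[K] MvPolynomial (Fin (m + 1)) K :=
    MvPolynomial.aeval (fun j => MvPolynomial.X (r.succAbove j)) with hι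
  have hιX : ∀ j, ι (MvPolynomial.X j) = MvPolynomial.X (r.succAbove j) :=
    fun i => MvPolynomial.aeval_X _ _
  have hψι : ψ.comp ι = AlgHom.id K _ := by
    apply MvPolynomial.algHom_ext
    intro j
    rw [AlgHom.comp_apply, hιX, hψX, hvs]; rfl
  have hC1 : ∀ b : K, ψ (MvPolynomial.C b) = MvPolynomial.C b := fun b => ψ.commutes b
  have hC2 : ∀ b : K, ι (MvPolynomial.C b) = MvPolynomial.C b := fun b => ι.commutes b
  have hlin : ψ (lin c) = 0 := by
    rw [lin, map_sum, Fin.sum_univ_succAbove _ r]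
    simp only [map_mul, hC1, hψX, hvr, hvs, ha, lin]
    rw [← mul_assoc, ← MvPolynomial.C_mul, mul_neg, mul_inv_cancel₀ hr]
    simp
  have hιa : MvPolynomial.X r - ι a = MvPolynomial.C (c r)⁻¹ * lin c := by
    rw [ha, map_mul, hC2, lin, lin, map_sum, Fin.sum_univ_succAbove _ r]
    simp only [map_mul, hC2, hιX, mul_add, MvPolynomial.C_neg]
    rw [← mul_assoc, ← MvPolynomial.C_mul, inv_mul_cancel₀ hr]
    simp
  have hmod : ∀ f, f - ι (ψ f) ∈ Ideal.span {lin c} := by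
    have h1 : (Ideal.Quotient.mkₐ K (Ideal.span {lin c})) =
        ((Ideal.Quotient.mkₐ K (Ideal.span {lin c})).comp ι).comp ψ := by
      apply MvPolynomial.algHom_ext
      intro i
      rw [AlgHom.comp_apply, AlgHom.comp_apply, hψX]
      rcases Fin.eq_self_or_eq_succAbove r i with rfl | ⟨j, rfl⟩
      · rw [hvr]
        simp only [Ideal.Quotient.mkₐ_eq_mk]
        rw [Ideal.Quotient.eq, hιa]
        exact Ideal.mul_mem_left _ _ (Ideal.mem_span_singleton_self _)
      · rw [hvs, hιX]
    intro f
    have h2 := DFunLike.congr_fun h1 f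
    simp only [AlgHom.comp_apply, Ideal.Quotient.mkₐ_eq_mk] at h2
    rwa [Ideal.Quotient.eq] at h2
  refine ⟨ψ, ?_, ?_, ?_, ?_⟩
  · intro g
    exact ⟨ι g, DFunLike.congr_fun hψι g⟩
  · apply le_antisymm
    · intro f hf
      have := hmod f
      rw [RingHom.mem_ker] at hf
      rwa [hf, map_zero, sub_zero] at this
    · rw [Ideal.span_singleton_le_iff_mem]
      exact hlin
  · intro f e hf
    have := hf.aeval (n := 1) v (by
      intro i
      rcases Fin.eq_self_or_eq_succAbove r i with rfl | ⟨j, rfl⟩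
      · rw [hvr, ha]; exact (lin_homog _).C_mul _
      · rw [hvs]; exact isHomogeneous_X _ _)
    rwa [one_mul] at this
  · intro y
    refine ⟨fun i => MvPolynomial.eval y (v i), ?_, ?_⟩
    · intro f
      have h1 : (MvPolynomial.aeval (R := K) (fun i => MvPolynomial.eval y (v i))) =
          (MvPolynomial.aeval (R := K) y).comp ψ := by
        apply MvPolynomial.algHom_ext
        intro i
        rw [AlgHom.comp_apply, hψX, MvPolynomial.aeval_X, aeval_eval]
      have h2 := DFunLike.congr_fun h1 f
      rwa [AlgHom.comp_apply, aeval_eval, aeval_eval] at h2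
    · intro hx
      ext j
      have := congrFun hx (r.succAbove j)
      simpa [hvs] using this

/-- If `l` is a nonzerodivisor and `F̄` is a regular sequence mod `l`, then `l` is a
nonzerodivisor modulo each initial segment of `F`. -/
lemma lin_nzd {R S : Type} [CommRing R] [CommRing S] [IsDomain R] (ψ : R →+* S)
    (hs : Function.Surjective ψ) {l : R} (hl : l ≠ 0) (hker : RingHom.ker ψ = Ideal.span {l})
    {m : ℕ} (F : Fin m → R)
    (hreg : ∀ k z, ψ (F k) * z ∈ Ideal.span ((fun j => ψ (F j)) '' {j | j < k}) →
      z ∈ Ideal.span ((fun j => ψ (F j)) '' {j | j < k})) :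
    ∀ k : ℕ, ∀ z, l * z ∈ Ideal.span (F '' {j | (j : ℕ) < k}) →
      z ∈ Ideal.span (F '' {j | (j : ℕ) < k}) := by
  intro k
  induction k with
  | zero =>
    intro z hz
    simp [hl] at hz
    simp [hz]
  | succ k ih =>
    intro z hz
    by_cases hk : k < m
    · have hset : {j : Fin m | (j : ℕ) < k + 1} = insert ⟨k, hk⟩ {j : Fin m | (j : ℕ) < k} := by
        ext j; simp [Fin.ext_iff]; omega
      rw [hset, Set.image_insert_eq, Ideal.span_insert] at hz ⊢
      obtain ⟨y, hy, i, hi, hyi⟩ := Submodule.mem_sup.1 hz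
      obtain ⟨a, rfl⟩ := Ideal.mem_span_singleton'.1 hy
      have hset2 : {j : Fin m | j < ⟨k, hk⟩} = {j : Fin m | (j : ℕ) < k} := by
        ext j; simp [Fin.lt_def]
      have himg : ∀ w ∈ Ideal.span (F '' {j | (j : ℕ) < k}),
          ψ w ∈ Ideal.span ((fun j => ψ (F j)) '' {j : Fin m | (j : ℕ) < k}) := by
        intro w hw
        have := Ideal.mem_map_of_mem ψ hw
        rwa [Ideal.map_span, Set.image_image] at this
      have hψl : ψ l = 0 := by
        rw [← RingHom.mem_ker, hker]; exact Ideal.mem_span_singleton_self _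
      have h1 : ψ a ∈ Ideal.span ((fun j => ψ (F j)) '' {j : Fin m | (j : ℕ) < k}) := by
        have := hreg ⟨k, hk⟩ (ψ a)
        rw [hset2] at this
        apply this
        have h2 := congrArg ψ hyi
        rw [map_add, map_mul, map_mul, hψl, zero_mul] at h2
        have h3 : ψ (F ⟨k, hk⟩) * ψ a = - ψ i := by
          linear_combination h2
        rw [h3]
        exact neg_mem (himg i hi)
      have h2 : a ∈ Ideal.span (F '' {j | (j : ℕ) < k}) ⊔ Ideal.span {l} := by
        rw [← hker]
        rw [RingHom.ker, ← Ideal.comap_map_of_surjective ψ hs, Ideal.mem_comap, Ideal.map_span,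
          Set.image_image]
        exact h1
      obtain ⟨i', hi', y', hy', rfl⟩ := Submodule.mem_sup.1 h2
      obtain ⟨b, rfl⟩ := Ideal.mem_span_singleton'.1 hy'
      have h3 : z - b * F ⟨k, hk⟩ ∈ Ideal.span (F '' {j | (j : ℕ) < k}) := by
        apply ih
        have : l * (z - b * F ⟨k, hk⟩) = i' * F ⟨k, hk⟩ + i := by
          linear_combination - hyi
        rw [this]
        exact add_mem (Ideal.mul_mem_right _ _ hi') hi
      have h4 : z = b * F ⟨k, hk⟩ + (z - b * F ⟨k, hk⟩) := by ring
      rw [h4]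
      exact add_mem (Ideal.mem_sup_left (Ideal.mul_mem_left _ _ (Ideal.mem_span_singleton_self _)))
        (Ideal.mem_sup_right h3)
    · have hset : {j : Fin m | (j : ℕ) < k + 1} = {j : Fin m | (j : ℕ) < k} := by
        ext j; simp; omega
      rw [hset] at hz ⊢
      exact ih z hz

/-- dimension count -/
lemma surj_of_inj {σ : Type} [Finite σ] {J : Ideal (MvPolynomial σ K)}
    (hJ : J.IsHomogeneous (homogeneousSubmodule σ K))
    {l F : MvPolynomial σ K} {d D : ℕ} (hF : F.IsHomogeneous d) (hl : l.IsHomogeneous 1)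
    (hinj : ∀ z, F * z ∈ J → z ∈ J)
    (hsurj : ∀ E, D < E → ∀ f : MvPolynomial σ K, f.IsHomogeneous E → f ∈ J ⊔ Ideal.span {l}) :
    ∀ f : MvPolynomial σ K, f.IsHomogeneous (d + D) → f ∈ J ⊔ Ideal.span {F} := by
  have h1 : ∀ k : ℕ, ∀ f : MvPolynomial σ K, f.IsHomogeneous (k + D) →
      ∃ i ∈ J, ∃ g : MvPolynomial σ K, g.IsHomogeneous D ∧ f = i + l ^ k * g := by
    intro k
    induction k with
    | zero => intro f hf; exact ⟨0, J.zero_mem, f, by simpa using hf, by simp⟩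
    | succ k ih =>
      intro f hf
      obtain ⟨i, hi, g, hg, rfl⟩ := homog_lift (e := k + D) hJ hl
        (by convert hf using 1; omega) (hsurj _ (by omega) f hf)
      obtain ⟨i', hi', g', hg', rfl⟩ := ih g hg
      exact ⟨i + l * i', J.add_mem hi (J.mul_mem_left _ hi'), g', hg', by ring⟩
  let q := (Ideal.Quotient.mkₐ K J).toLinearMap
  have hq : ∀ f, q f = Ideal.Quotient.mk J f := fun f => rfl
  let V : ℕ → Submodule K (MvPolynomial σ K ⧸ J) := fun e => (homogeneousSubmodule σ K e).map q
  have hVfin : ∀ e, Module.Finite K (V e) := fun e =>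
    Module.Finite.iff_fg.2 ((homogeneousSubmodule_fg σ K e).map q)
  let μ : MvPolynomial σ K → (MvPolynomial σ K ⧸ J) →ₗ[K] (MvPolynomial σ K ⧸ J) :=
    fun g => LinearMap.mulLeft K (Ideal.Quotient.mk J g)
  have hμ : ∀ g f, μ g (q f) = q (g * f) := by
    intro g f; simp [μ, hq]
  have hle : (V D).map (μ F) ≤ V (d + D) := by
    rintro _ ⟨_, ⟨g, hg, rfl⟩, rfl⟩
    exact ⟨F * g, hF.mul hg, (hμ F g).symm⟩
  have hle2 : V (d + D) ≤ (V D).map (μ (l ^ d)) := by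
    rintro _ ⟨f, hf, rfl⟩
    obtain ⟨i, hi, g, hg, rfl⟩ := h1 d f hf
    refine ⟨q g, ⟨g, hg, rfl⟩, ?_⟩
    rw [hμ, map_add]
    have : q i = 0 := Ideal.Quotient.eq_zero_iff_mem.2 hi
    rw [this, zero_add]
  have hinj2 : Function.Injective (μ F) := by
    rw [injective_iff_map_eq_zero]
    intro y hy
    obtain ⟨z, rfl⟩ := Ideal.Quotient.mk_surjective y
    rw [← hq, hμ] at hy
    exact Ideal.Quotient.eq_zero_iff_mem.2 (hinj z (Ideal.Quotient.eq_zero_iff_mem.1 hy))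
  have hrank : Module.finrank K (V (d + D)) ≤ Module.finrank K ((V D).map (μ F)) := by
    rw [← (Submodule.equivMapOfInjective (μ F) hinj2 (V D)).finrank_eq]
    have : Module.Finite K ((V D).map (μ (l ^ d))) := Module.Finite.map _ _
    exact (Submodule.finrank_mono hle2).trans (Submodule.finrank_map_le _ _)
  have heq := Submodule.eq_of_le_of_finrank_le hle hrank
  intro f hf
  have hfV : q f ∈ V (d + D) := ⟨f, hf, rfl⟩
  rw [← heq] at hfV
  obtain ⟨_, ⟨g, hg, rfl⟩, hgf⟩ := hfV
  rw [hμ] at hgf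
  have : f - F * g ∈ J := Ideal.Quotient.eq.1 hgf.symm
  have h4 : f = (f - F * g) + F * g := by ring
  rw [h4]
  exact add_mem (Ideal.mem_sup_left this)
    (Ideal.mem_sup_right (Ideal.mul_mem_right _ _ (Ideal.mem_span_singleton_self _)))

/-- Macaulay's theorem -/
theorem macaulay [IsAlgClosed K] : ∀ (m : ℕ) (d : Fin m → ℕ) (F : Fin m → MvPolynomial (Fin m) K),
    (∀ i, (F i).IsHomogeneous (d i)) → (∀ i, 0 < d i) →
    (∀ x : Fin m → K, (∀ i, MvPolynomial.eval x (F i) = 0) → x = 0) →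
    (∀ k z, F k * z ∈ Ideal.span (F '' {j | j < k}) → z ∈ Ideal.span (F '' {j | j < k})) ∧
    (∀ D f, f.IsHomogeneous D → ∑ i, d i + 1 ≤ D + m → f ∈ Ideal.span (Set.range F)) := by
  intro m
  induction m with
  | zero =>
    intro d F _ _ _
    refine ⟨fun k => k.elim0, fun D f hf hD => ?_⟩
    have h0 : f = 0 := by
      by_contra hne
      have := hf.inj_right (isHomogeneous_of_isEmpty _ _ f) hne
      simp at hD
      omega
    rw [h0]; exact Submodule.zero_mem _
  | succ m ih =>
    intro d F hF hd h0
    set Fres : Fin m → MvPolynomial (Fin (m + 1)) K := fun i => F i.castSucc with hF'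
    set J := Ideal.span (Set.range Fres) with hJd
    have hI : ∀ s, (Ideal.span (Fres '' s)).IsHomogeneous (homogeneousSubmodule (Fin (m + 1)) K) :=
      homog_span Fres (fun i => d i.castSucc) (fun i => hF _)
    have hJ : J.IsHomogeneous (homogeneousSubmodule (Fin (m + 1)) K) := by
      rw [hJd, ← Set.image_univ]; exact hI _
    have hJmem : ∀ i, Fres i ∈ J := fun i => Ideal.subset_span ⟨i, rfl⟩
    obtain ⟨c, hc, hcz⟩ := exists_linear hJ (hd (Fin.last m)) (hF (Fin.last m)) (by
      intro x hx hl
      apply h0 x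
      intro i
      induction i using Fin.lastCases with
      | last => exact hl
      | cast i => exact hx _ (hJmem i))
    obtain ⟨ψ, hψs, hψk, hψh, hψe⟩ := exists_restrict hc
    obtain ⟨hA, hB⟩ := ih (fun i => d i.castSucc) (fun i => ψ (Fres i))
      (fun i => hψh _ _ (hF _)) (fun i => hd _) (by
        intro y hy
        obtain ⟨x, hx, hxy⟩ := hψe y
        apply hxy
        apply hcz
        · intro f hf
          have : J ≤ RingHom.ker (MvPolynomial.eval x) := by
            rw [hJd, Ideal.span_le]
            rintro _ ⟨i, rfl⟩
            change MvPolynomial.eval x (Fres i) = 0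
            rw [hx]; exact hy i
          exact this hf
        · rw [← lin_eval, hx]
          have : lin c ∈ RingHom.ker ψ := by
            rw [hψk]; exact Ideal.mem_span_singleton_self _
          rw [RingHom.mem_ker.1 this, map_zero])
    have hlnzd := lin_nzd ψ.toRingHom hψs (lin_ne hc) hψk Fres hA
    have hJeq : Fres '' {j | (j : ℕ) < m} = Set.range Fres := by
      rw [← Set.image_univ]; congr 1; ext j; simp
    have hlJ : ∀ z, lin c * z ∈ J → z ∈ J := by
      have := hlnzd m
      rwa [hJeq] at this
    -- regularity, last step
    have hlast : ∀ z, F (Fin.last m) * z ∈ J → z ∈ J := by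
      have hrad : lin c ∈ (J ⊔ Ideal.span {F (Fin.last m)}).radical := by
        apply exists_pow_mem
        · intro x hx
          apply h0 x
          intro i
          induction i using Fin.lastCases with
          | last => exact hx _ (Ideal.mem_sup_right (Ideal.mem_span_singleton_self _))
          | cast i => exact hx _ (Ideal.mem_sup_left (hJmem i))
        · rw [lin_eval]; simp
      obtain ⟨N, hN⟩ := hrad
      obtain ⟨j, hj, y, hy, hjy⟩ := Submodule.mem_sup.1 hN
      obtain ⟨g, rfl⟩ := Ideal.mem_span_singleton'.1 hy
      intro z hz
      have hpow : ∀ k : ℕ, lin c ^ k * z ∈ J → z ∈ J := by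
        intro k
        induction k with
        | zero => intro h; simpa using h
        | succ k ihk =>
          intro h
          apply ihk
          apply hlJ
          rwa [← mul_assoc, ← pow_succ']
      apply hpow N
      have : lin c ^ N * z = j * z + g * (F (Fin.last m) * z) := by
        rw [← hjy]; ring
      rw [this]
      exact add_mem (Ideal.mul_mem_right _ _ hj) (Ideal.mul_mem_left _ _ hz)
    have himc : ∀ k : Fin m, F '' {j | j < k.castSucc} = Fres '' {j | j < k} := by
      intro k
      ext f
      constructor
      · rintro ⟨j, hj, rfl⟩
        have hjm : (j : ℕ) < m := lt_trans hj k.2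
        exact ⟨⟨j, hjm⟩, hj, rfl⟩
      · rintro ⟨j, hj, rfl⟩
        exact ⟨j.castSucc, hj, rfl⟩
    have himl : F '' {j | j < Fin.last m} = Set.range Fres := by
      ext f
      constructor
      · rintro ⟨j, hj, rfl⟩
        exact ⟨⟨j, hj⟩, rfl⟩
      · rintro ⟨j, rfl⟩
        exact ⟨j.castSucc, Fin.castSucc_lt_last j, rfl⟩
    have hrange : Ideal.span (Set.range F) = J ⊔ Ideal.span {F (Fin.last m)} := by
      rw [hJd, ← Ideal.span_union]
      congr 1
      ext f
      constructor
      · rintro ⟨j, rfl⟩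
        induction j using Fin.lastCases with
        | last => right; rfl
        | cast i => left; exact ⟨i, rfl⟩
      · rintro (⟨j, rfl⟩ | h)
        · exact ⟨_, rfl⟩
        · exact ⟨Fin.last m, h.symm⟩
    refine ⟨?_, ?_⟩
    · intro k
      induction k using Fin.lastCases with
      | last => rw [himl]; exact hlast
      | cast k =>
        rw [himc]
        have hsetk : {j : Fin m | j < k} = {j : Fin m | (j : ℕ) < (k : ℕ)} := rfl
        set I := Ideal.span (Fres '' {j | j < k}) with hId
        let N : Ideal (MvPolynomial (Fin (m + 1)) K) :=
          { carrier := {z | Fres k * z ∈ I}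
            add_mem' := by
              intro a b ha hb
              change Fres k * (a + b) ∈ I
              rw [mul_add]; exact add_mem ha hb
            zero_mem' := by
              change Fres k * 0 ∈ I
              rw [mul_zero]; exact zero_mem _
            smul_mem' := by
              intro a b hb
              change Fres k * (a * b) ∈ I
              rw [mul_left_comm]; exact Ideal.mul_mem_left _ _ hb }
        have hNI : N ≤ I := by
          apply nak (hI _) (lin_homog c)
          intro z hz
          have hz' : Fres k * z ∈ I := hz
          have h1 : ψ z ∈ Ideal.span ((fun j => ψ (Fres j)) '' {j | j < k}) := by
            apply hA k
            rw [← map_mul]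
            have := Ideal.mem_map_of_mem ψ hz'
            rwa [hId, Ideal.map_span, Set.image_image] at this
          have h2 : z ∈ I ⊔ Ideal.span {lin c} := by
            rw [← hψk, RingHom.ker, ← Ideal.comap_map_of_surjective ψ hψs, Ideal.mem_comap, hId,
              Ideal.map_span, Set.image_image]
            exact h1
          obtain ⟨i, hi, y, hy, rfl⟩ := Submodule.mem_sup.1 h2
          obtain ⟨w, rfl⟩ := Ideal.mem_span_singleton'.1 hy
          refine ⟨i, hi, w, ?_, by ring⟩
          change Fres k * w ∈ I
          apply hlnzd k
          have : lin c * (Fres k * w) = Fres k * (i + w * lin c) - Fres k * i := by ring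
          rw [this]
          exact sub_mem hz' (Ideal.mul_mem_left _ _ hi)
        intro z hz
        exact hNI hz
    · intro D f hf hD
      rw [hrange]
      rw [Fin.sum_univ_castSucc] at hD
      have hge : m ≤ ∑ i : Fin m, d i.castSucc := by
        calc m = ∑ i : Fin m, 1 := by simp
          _ ≤ _ := Finset.sum_le_sum fun i _ => hd _
      obtain ⟨D0, rfl⟩ : ∃ D0, D = d (Fin.last m) + D0 := ⟨D - d (Fin.last m), by omega⟩
      apply surj_of_inj hJ (hF (Fin.last m)) (lin_homog c) hlast _ f hf
      intro E hE g hg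
      have h1 := hB E (ψ g) (hψh _ _ hg) (by omega)
      rw [← hψk, RingHom.ker, ← Ideal.comap_map_of_surjective ψ hψs, Ideal.mem_comap, hJd,
        Ideal.map_span, ← Set.range_comp]
      exact h1

lemma homog_sum {R : Type} [CommRing R] {m D : ℕ} {f : MvPolynomial (Fin m) R}
    (hf : f.IsHomogeneous D) :
    f = ∑ c : Sym (Fin m) D, MvPolynomial.monomial (Multiset.toFinsupp (c : Multiset (Fin m)))
      (MvPolynomial.coeff (Multiset.toFinsupp (c : Multiset (Fin m))) f) := by
  ext δ
  rw [MvPolynomial.coeff_sum]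
  simp only [MvPolynomial.coeff_monomial]
  by_cases hδ : δ.degree = D
  · have hcard : Multiset.card (Finsupp.toMultiset δ) = D := by
      rw [Finsupp.card_toMultiset, ← hδ]; rfl
    symm
    refine (Finset.sum_eq_single (⟨Finsupp.toMultiset δ, hcard⟩ : Sym (Fin m) D) ?_ ?_).trans ?_
    · intro c _ hc
      rw [if_neg]
      rintro rfl
      apply hc
      apply Subtype.ext
      exact (Multiset.toFinsupp_toMultiset _).symm
    · exact fun h => absurd (Finset.mem_univ (α := Sym (Fin m) D) _) h
    · simp
  · rw [hf.coeff_eq_zero hδ, Finset.sum_eq_zero]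
    intro c _
    rw [if_neg]
    rintro rfl
    apply hδ
    have h1 : Multiset.card (c : Multiset (Fin m)) = D := c.2
    conv_rhs => rw [← h1, ← Multiset.toFinsupp_toMultiset (c : Multiset (Fin m)),
      Finsupp.card_toMultiset]
    rfl

lemma mono_homog {R : Type} [CommRing R] {m D : ℕ} (c : Sym (Fin m) D) (a : R) :
    (MvPolynomial.monomial (Multiset.toFinsupp (c : Multiset (Fin m))) a).IsHomogeneous D := by
  apply isHomogeneous_monomial
  have h1 : Multiset.card (c : Multiset (Fin m)) = D := c.2
  conv_rhs => rw [← h1, ← Multiset.toFinsupp_toMultiset (c : Multiset (Fin m)),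
    Finsupp.card_toMultiset]
  rfl

lemma phi_homog {n : ℕ} (j : Fin n) {f : MvPolynomial (Fin (n - 1)) K} {e : ℕ}
    (hf : f.IsHomogeneous e) : (PhiFull K n j f).IsHomogeneous e := by
  unfold PhiFull
  split_ifs with h
  · have := hf.aeval (n := 1) (fun i : Fin (n - 1) => if i = ⟨j, h⟩ then
      -MvPolynomial.X ⟨j, h⟩ else MvPolynomial.X i - (MvPolynomial.X ⟨j, h⟩ :
        MvPolynomial (Fin (n - 1)) K)) (by
      intro i
      split_ifs
      · exact (isHomogeneous_X _ _).neg
      · exact (isHomogeneous_X _ _).sub (isHomogeneous_X _ _))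
    rw [one_mul] at this
    exact this
  · exact hf

lemma esymm_homog {R : Type} [CommRing R] {m e : ℕ} :
    (MvPolynomial.esymm (Fin m) R e).IsHomogeneous e := by
  rw [MvPolynomial.esymm]
  refine MvPolynomial.IsHomogeneous.sum _ _ _ fun t ht => ?_
  have := MvPolynomial.IsHomogeneous.prod t (fun i => (MvPolynomial.X i : MvPolynomial (Fin m) R))
    (fun _ => 1) (fun i _ => isHomogeneous_X _ _)
  simpa [(Finset.mem_powersetCard.1 ht).2] using this

lemma G_homog {n : ℕ} (T : Fin (n - 1) → Fin n) (i : Fin (n - 1)) :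
    (G K n T i).IsHomogeneous ((i : ℕ) + 1) := phi_homog _ esymm_homog

lemma phi_map {n : ℕ} (j : Fin n) (f : MvPolynomial (Fin (n - 1)) ℤ) :
    MvPolynomial.map (Int.castRingHom K) (PhiFull ℤ n j f) =
      PhiFull K n j (MvPolynomial.map (Int.castRingHom K) f) := by
  unfold PhiFull
  split_ifs with h
  · induction f using MvPolynomial.induction_on with
    | C a => simp [Phi]
    | add p q hp hq => simp only [map_add, hp, hq]
    | mul_X p i hp =>
      simp only [map_mul, hp, MvPolynomial.map_X]
      congr 1
      simp only [Phi, MvPolynomial.aeval_X]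
      split_ifs <;> simp
  · rfl

lemma G_map {n : ℕ} (T : Fin (n - 1) → Fin n) (i : Fin (n - 1)) :
    MvPolynomial.map (Int.castRingHom K) (G ℤ n T i) = G K n T i := by
  unfold G
  rw [phi_map, MvPolynomial.map_esymm]

lemma casasM_cast {n : ℕ} (T : Fin (n - 1) → Fin n) (r) (c) :
    ((casasM n T r c : ℤ) : K) =
      MvPolynomial.coeff (Multiset.toFinsupp (c : Multiset (Fin (n - 1))))
      (MvPolynomial.monomial (Multiset.toFinsupp (r.2 : Multiset (Fin (n - 1)))) 1 * G K n T r.1) := by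
  unfold casasM
  rw [← G_map (K := K) T r.1]
  have : (MvPolynomial.monomial (Multiset.toFinsupp (r.2 : Multiset (Fin (n - 1)))) (1 : K)) =
    MvPolynomial.map (Int.castRingHom K)
      (MvPolynomial.monomial (Multiset.toFinsupp (r.2 : Multiset (Fin (n - 1)))) (1 : ℤ)) := by
    rw [MvPolynomial.map_monomial]; simp
  rw [this, ← map_mul, MvPolynomial.coeff_map]
  rfl

lemma casasD_facts {n : ℕ} (hn : 2 ≤ n) :
    n - 1 ≤ casasD n ∧ ∑ i : Fin (n - 1), ((i : ℕ) + 1) + 1 ≤ casasD n + (n - 1) := by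
  obtain ⟨k, rfl⟩ : ∃ k, n = k + 2 := ⟨n - 2, by omega⟩
  have hN : k + 2 - 1 = k + 1 := by omega
  have hsum : ∀ N : ℕ, (∑ i : Fin N, ((i : ℕ) + 1)) * 2 = N * (N + 1) := by
    intro N
    induction N with
    | zero => simp
    | succ N ih =>
      rw [Fin.sum_univ_castSucc, add_mul]
      simp only [Fin.val_castSucc, Fin.val_last]
      rw [ih]; ring
  have h2 := hsum (k + 2 - 1)
  have hD : k * k + k + 2 ≤ (k + 2) ^ 2 - 3 * (k + 2) + 4 := by
    have : (k + 2) ^ 2 = k * k + 4 * k + 4 := by ring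
    rw [this]; omega
  have hk : k ≤ k * k := Nat.le_mul_self k
  have h3 : (k + 2 - 1) * (k + 2 - 1 + 1) = k * k + 3 * k + 2 := by
    rw [hN]; ring
  rw [h3] at h2
  unfold casasD
  omega

/-- A nontrivial zero kills all maximal minors. -/
lemma dvd_of_zero {n p : ℕ} (hn : 2 ≤ n) [CharP K p] (T : Fin (n - 1) → Fin n)
    (x : Fin (n - 1) → K) (hx : x ≠ 0) (h : ∀ i, MvPolynomial.eval x (G K n T i) = 0) :
    (p : ℤ) ∣ casasJ n T := by
  unfold casasJ
  apply Finset.dvd_gcd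
  intro f _
  rw [← CharP.intCast_eq_zero_iff K p]
  have hdet : ((((casasM n T).submatrix f id).det : ℤ) : K) =
      (((casasM n T).submatrix f id).map (Int.castRingHom K)).det := by
    have := RingHom.map_det (Int.castRingHom K) ((casasM n T).submatrix f id)
    exact this
  rw [hdet]
  obtain ⟨k, hk⟩ := Function.ne_iff.1 hx
  simp only [Pi.zero_apply] at hk
  let v : Sym (Fin (n - 1)) (casasD n) → K := fun c => MvPolynomial.eval x
    (MvPolynomial.monomial (Multiset.toFinsupp (c : Multiset (Fin (n - 1)))) 1)
  have hev : ∀ g : MvPolynomial (Fin (n - 1)) K, g.IsHomogeneous (casasD n) →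
      MvPolynomial.eval x g = ∑ c : Sym (Fin (n - 1)) (casasD n),
        MvPolynomial.coeff (Multiset.toFinsupp (c : Multiset (Fin (n - 1)))) g * v c := by
    intro g hg
    conv_lhs => rw [homog_sum hg]
    rw [map_sum]
    refine Finset.sum_congr rfl fun c _ => ?_
    simp [v, MvPolynomial.eval_monomial]
  refine Matrix.exists_mulVec_eq_zero_iff.1 ⟨v, ?_, ?_⟩
  · intro hv
    have h1 := hev (MvPolynomial.X k ^ casasD n) (isHomogeneous_X_pow _ _)
    rw [hv] at h1
    simp at h1
    exact hk h1.1
  · ext c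
    have hle := (casasD_facts hn).1
    have hi := (f c).1.2
    have h1 := hev (MvPolynomial.monomial
      (Multiset.toFinsupp ((f c).2 : Multiset (Fin (n - 1)))) 1 * G K n T (f c).1) (by
        have h0 := (mono_homog (f c).2 (1 : K)).mul (G_homog T (f c).1)
        rw [Nat.sub_add_cancel (by omega)] at h0
        exact h0)
    rw [map_mul, h, mul_zero] at h1
    rw [Matrix.mulVec, dotProduct, Pi.zero_apply, h1]
    refine Finset.sum_congr rfl fun c' _ => ?_
    rw [← casasM_cast]
    rfl

lemma exists_minor {R C : Type} [Fintype R] [Fintype C] [DecidableEq C] (A : Matrix R C K)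
    (hA : ⊤ ≤ Submodule.span K (Set.range A.row)) :
    ∃ f : C → R, Function.Injective f ∧ (A.submatrix f id).det ≠ 0 := by
  obtain ⟨κ, a, ha, hspan, hli⟩ := exists_linearIndependent' K A.row
  rw [← hspan] at hA
  let b := Module.Basis.mk hli hA
  have e : C ≃ κ := (Pi.basisFun K C).indexEquiv b
  refine ⟨a ∘ e, ha.comp e.injective, ?_⟩
  have hli2 : LinearIndependent K (A.submatrix (a ∘ e) id).row := hli.comp e e.injective
  rw [Matrix.linearIndependent_rows_iff_isUnit] at hli2
  exact ((Matrix.isUnit_iff_isUnit_det _).1 hli2).ne_zero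

/-- If all minors vanish, there is a nontrivial zero. -/
lemma zero_of_dvd {n p : ℕ} (hn : 2 ≤ n) [CharP K p] [IsAlgClosed K] (T : Fin (n - 1) → Fin n)
    (h : (p : ℤ) ∣ casasJ n T) :
    ∃ x : Fin (n - 1) → K, x ≠ 0 ∧ ∀ i, MvPolynomial.eval x (G K n T i) = 0 := by
  by_contra hcon
  push Not at hcon
  have hmac := (macaulay (n - 1) (fun i => (i : ℕ) + 1) (G K n T) (G_homog T) (fun i => by omega)
    (by
      intro x hx
      by_contra hx0
      obtain ⟨i, hi⟩ := hcon x hx0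
      exact hi (hx i))).2
  obtain ⟨hle, hsum⟩ := casasD_facts hn
  let A := (casasM n T).map (Int.castRingHom K)
  have hspan : ⊤ ≤ Submodule.span K (Set.range A.row) := by
    intro w _
    let fw : MvPolynomial (Fin (n - 1)) K := ∑ c : Sym (Fin (n - 1)) (casasD n),
      MvPolynomial.monomial (Multiset.toFinsupp (c : Multiset (Fin (n - 1)))) (w c)
    have hfw : fw.IsHomogeneous (casasD n) :=
      MvPolynomial.IsHomogeneous.sum _ _ _ fun c _ => mono_homog c _
    have hw : ∀ c : Sym (Fin (n - 1)) (casasD n),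
        MvPolynomial.coeff (Multiset.toFinsupp (c : Multiset (Fin (n - 1)))) fw = w c := by
      intro c
      simp only [fw, MvPolynomial.coeff_sum, MvPolynomial.coeff_monomial]
      rw [Finset.sum_eq_single c]
      · simp
      · intro c' _ hc'
        rw [if_neg]
        intro h1
        exact hc' (Sym.coe_injective (Multiset.toFinsupp.injective h1))
      · simp
    obtain ⟨g, hg⟩ := (Ideal.mem_span_range_iff_exists_fun).1 (hmac _ fw hfw hsum)
    have hfw2 : fw = ∑ r : (i : Fin (n - 1)) × Sym (Fin (n - 1)) (casasD n - ((i : ℕ) + 1)),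
        (MvPolynomial.coeff (Multiset.toFinsupp (r.2 : Multiset (Fin (n - 1))))
          (homogeneousComponent (casasD n - ((r.1 : ℕ) + 1)) (g r.1))) •
        (MvPolynomial.monomial (Multiset.toFinsupp (r.2 : Multiset (Fin (n - 1)))) 1 *
          G K n T r.1) := by
      rw [Fintype.sum_sigma]
      rw [← homogeneousComponent_eq_self hfw, ← hg, map_sum]
      refine Finset.sum_congr rfl fun i _ => ?_
      have hi := i.2
      have hdeg : casasD n = ((i : ℕ) + 1) + (casasD n - ((i : ℕ) + 1)) := by omega
      conv_lhs => rw [hdeg, mul_comm, hc_mul (G_homog T i), mul_comm,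
        homog_sum (homogeneousComponent_isHomogeneous _ (g i)), Finset.sum_mul]
      refine Finset.sum_congr rfl fun α _ => ?_
      rw [← smul_mul_assoc, MvPolynomial.smul_monomial, smul_eq_mul, mul_one]
    have hw2 : w = ∑ r : (i : Fin (n - 1)) × Sym (Fin (n - 1)) (casasD n - ((i : ℕ) + 1)),
        (MvPolynomial.coeff (Multiset.toFinsupp (r.2 : Multiset (Fin (n - 1))))
          (homogeneousComponent (casasD n - ((r.1 : ℕ) + 1)) (g r.1))) • A.row r := by
      ext c
      rw [← hw c, hfw2, MvPolynomial.coeff_sum, Finset.sum_apply]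
      refine Finset.sum_congr rfl fun r _ => ?_
      rw [MvPolynomial.coeff_smul, ← casasM_cast]
      rfl
    rw [hw2]
    exact Submodule.sum_mem _ fun r _ => Submodule.smul_mem _ _ (Submodule.subset_span ⟨r, rfl⟩)
  obtain ⟨f, hf, hdet⟩ := exists_minor A hspan
  apply hdet
  have hdvd : (p : ℤ) ∣ ((casasM n T).submatrix f id).det :=
    h.trans (Finset.gcd_dvd (by simpa using hf))
  rw [← CharP.intCast_eq_zero_iff K p] at hdvd
  have := RingHom.map_det (Int.castRingHom K) ((casasM n T).submatrix f id)
  rw [← hdvd]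
  exact this.symm

lemma eval_phi_esymm {m e : ℕ} (φ : MvPolynomial (Fin m) K →ₐ[K] MvPolynomial (Fin m) K)
    (x : Fin m → K) :
    MvPolynomial.eval x (φ (MvPolynomial.esymm (Fin m) K e)) =
      (Finset.univ.val.map fun k => MvPolynomial.eval x (φ (MvPolynomial.X k))).esymm e := by
  rw [← MvPolynomial.aeval_esymm_eq_multiset_esymm (Fin m) K]
  have h1 : (MvPolynomial.aeval (R := K) x).comp φ =
      MvPolynomial.aeval (fun k => MvPolynomial.eval x (φ (MvPolynomial.X k))) := by
    apply MvPolynomial.algHom_ext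
    intro i
    rw [AlgHom.comp_apply, MvPolynomial.aeval_X, aeval_eval]
  rw [← h1, AlgHom.comp_apply, aeval_eval]

lemma prod_phi {m : ℕ} (r : Fin (m + 1) → K) (j : Fin (m + 1)) :
    ∏ k, (Polynomial.X - Polynomial.C (r k - r j)) =
      Polynomial.X * ∏ k : Fin m, (Polynomial.X - Polynomial.C
        (MvPolynomial.eval (fun k : Fin m => r k.castSucc - r (Fin.last m))
          (PhiFull K (m + 1) j (MvPolynomial.X k)))) := by
  rw [Fin.prod_univ_castSucc]
  induction j using Fin.lastCases with
  | last =>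
    have h : ∀ k : Fin m, PhiFull K (m + 1) (Fin.last m) (MvPolynomial.X k) = MvPolynomial.X k := by
      intro k
      unfold PhiFull
      rw [dif_neg (by simp)]
      rfl
    simp only [h, MvPolynomial.eval_X, sub_self, map_zero, sub_zero]
    rw [mul_comm]
  | cast j =>
    have h : ∀ k : Fin m, PhiFull K (m + 1) j.castSucc (MvPolynomial.X k) =
        if k = j then -MvPolynomial.X j else MvPolynomial.X k - MvPolynomial.X j := by
      intro k
      unfold PhiFull
      rw [dif_pos (show ((j.castSucc : Fin (m + 1)) : ℕ) < m + 1 - 1 by simp)]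
      exact MvPolynomial.aeval_X _ _
    simp only [h]
    rw [← Finset.mul_prod_erase Finset.univ _ (Finset.mem_univ j),
      ← Finset.mul_prod_erase Finset.univ (fun k : Fin m => Polynomial.X - Polynomial.C
        (MvPolynomial.eval (fun k : Fin m => r k.castSucc - r (Fin.last m))
          (if k = j then -MvPolynomial.X j else MvPolynomial.X k - MvPolynomial.X j)))
        (Finset.mem_univ j)]
    have h2 : ∏ k ∈ Finset.univ.erase j, (Polynomial.X - Polynomial.C
        (MvPolynomial.eval (fun k : Fin m => r k.castSucc - r (Fin.last m))
          (if k = j then -MvPolynomial.X j else MvPolynomial.X k - MvPolynomial.X j))) =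
        ∏ k ∈ Finset.univ.erase j, (Polynomial.X - Polynomial.C (r k.castSucc - r j.castSucc)) := by
      refine Finset.prod_congr rfl fun k hk => ?_
      rw [if_neg (Finset.ne_of_mem_erase hk)]
      simp
    rw [h2, if_pos rfl]
    simp
    ring

lemma root_iff {m : ℕ} (r : Fin (m + 1) → K) (T : Fin (m + 1 - 1) → Fin (m + 1))
    (i : Fin (m + 1 - 1)) :
    MvPolynomial.eval (fun k : Fin m => r k.castSucc - r (Fin.last m)) (G K (m + 1) T i) = 0 ↔
      Polynomial.eval (r (T i)) (Polynomial.hasseDeriv (m - i)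
        (∏ k, (Polynomial.X - Polynomial.C (r k)))) = 0 := by
  have hi : (i : ℕ) < m := i.2
  rw [← Polynomial.taylor_coeff]
  have h1 : Polynomial.taylor (r (T i)) (∏ k, (Polynomial.X - Polynomial.C (r k))) =
      ∏ k, (Polynomial.X - Polynomial.C (r k - r (T i))) := by
    rw [Polynomial.taylor_apply, Polynomial.prod_comp]
    refine Finset.prod_congr rfl fun k _ => ?_
    simp
    ring
  rw [h1, prod_phi]
  obtain ⟨q, hq⟩ : ∃ q, m - (i : ℕ) = q + 1 := ⟨m - i - 1, by omega⟩
  rw [hq, Polynomial.coeff_X_mul]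
  set y : Fin m → K := fun k => MvPolynomial.eval (fun k : Fin m => r k.castSucc - r (Fin.last m))
          (PhiFull K (m + 1) (T i) (MvPolynomial.X k)) with hy
  have h2 := Multiset.prod_X_sub_C_coeff (Finset.univ.val.map y) (k := q) (by simp; omega)
  rw [Multiset.map_map] at h2
  have h3 : (∏ k : Fin m, (Polynomial.X - Polynomial.C (y k))).coeff q =
    (Multiset.map ((fun t => Polynomial.X - Polynomial.C t) ∘ y) Finset.univ.val).prod.coeff q := rfl
  rw [h3, h2]
  have hc : Multiset.card (Multiset.map y Finset.univ.val) = m := by simp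
  rw [hc]
  have hmq : m - q = (i : ℕ) + 1 := by omega
  rw [hmq]
  have h4 : MvPolynomial.eval (fun k : Fin m => r k.castSucc - r (Fin.last m)) (G K (m + 1) T i) =
      (Finset.univ.val.map y).esymm ((i : ℕ) + 1) :=
    eval_phi_esymm (PhiFull K (m + 1) (T i)) _
  rw [h4]
  simp

theorem bad_imp {m p : ℕ} (hm : 1 ≤ m) (h : IsBadPrime (m + 1) p) :
    ∃ T : Fin (m + 1 - 1) → Fin (m + 1), (p : ℤ) ∣ casasJ (m + 1) T := by
  obtain ⟨_, L, _, _, _, f, ⟨hmon, hdeg, hCA⟩, hne⟩ := h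
  have hsplit : f.Splits := IsAlgClosed.splits f
  have hcard : Multiset.card f.roots = m + 1 := by
    rw [← hdeg]; exact hsplit.natDegree_eq_card_roots.symm
  obtain ⟨r, hr⟩ : ∃ r : Fin (m + 1) → L, f.roots = Finset.univ.val.map r := by
    refine ⟨fun k => f.roots.toList.get (k.cast (by simp [hcard])), ?_⟩
    have h1 : f.roots = (f.roots.toList : Multiset L) := (Multiset.coe_toList _).symm
    conv_lhs => rw [h1]
    rw [Fin.univ_val_map]
    congr 1
    apply List.ext_get
    · simp [hcard]
    · intro k h1 h2
      simp only [List.get_eq_getElem, List.getElem_ofFn, Fin.val_cast]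
  have hf : f = ∏ k, (Polynomial.X - Polynomial.C (r k)) := by
    have h1 := hsplit.eq_prod_roots_of_monic hmon
    rw [hr, Multiset.map_map] at h1
    exact h1
  have hroot : ∀ i : Fin (m + 1 - 1), ∃ j, Polynomial.eval (r j)
      (Polynomial.hasseDeriv (m - i) f) = 0 := by
    intro i
    have hi : (i : ℕ) < m := i.2
    obtain ⟨g, hg, hgf, hgh⟩ := hCA (m - i) (Finset.mem_Ioo.2 ⟨by omega, by omega⟩)
    obtain ⟨a, ha⟩ := IsAlgClosed.exists_root g hg.ne'
    have hfa : f.IsRoot a := ha.dvd hgf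
    have hmem : a ∈ f.roots := (Polynomial.mem_roots hmon.ne_zero).2 hfa
    rw [hr, Multiset.mem_map] at hmem
    obtain ⟨j, _, rfl⟩ := hmem
    exact ⟨j, ha.dvd hgh⟩
  choose T hT using hroot
  refine ⟨T, dvd_of_zero (K := L) (by omega) T (fun k : Fin m => r k.castSucc - r (Fin.last m)) ?_ ?_⟩
  · intro h0
    apply hne
    refine ⟨r (Fin.last m), ?_⟩
    rw [hf]
    have : ∀ k, r k = r (Fin.last m) := by
      intro k
      induction k using Fin.lastCases with
      | last => rfl
      | cast k => exact sub_eq_zero.1 (congrFun h0 k)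
    rw [Finset.prod_congr rfl fun k _ => by rw [this k]]
    simp
  · intro i
    rw [root_iff, ← hf]
    exact hT i

theorem imp_bad {m p : ℕ} (hm : 1 ≤ m) (hp : p.Prime) (T : Fin (m + 1 - 1) → Fin (m + 1))
    (h : (p : ℤ) ∣ casasJ (m + 1) T) : IsBadPrime (m + 1) p := by
  have : Fact p.Prime := ⟨hp⟩
  have hchar : CharP (AlgebraicClosure (ZMod p)) p :=
    charP_of_injective_algebraMap (algebraMap (ZMod p) (AlgebraicClosure (ZMod p))).injective p
  obtain ⟨x, hx, hxz⟩ := zero_of_dvd (K := AlgebraicClosure (ZMod p)) (by omega) T h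
  let r : Fin (m + 1) → AlgebraicClosure (ZMod p) := Fin.snoc (α := fun _ => _) x 0
  have hrx : (fun k : Fin m => r k.castSucc - r (Fin.last m)) = x := by
    ext k; simp [r]
  refine ⟨hp, AlgebraicClosure (ZMod p), inferInstance, inferInstance, hchar,
    ∏ k, (Polynomial.X - Polynomial.C (r k)), ⟨?_, ?_, ?_⟩, ?_⟩
  · exact Polynomial.monic_prod_of_monic _ _ fun k _ => Polynomial.monic_X_sub_C _
  · rw [Polynomial.natDegree_prod_of_monic _ _ fun k _ => Polynomial.monic_X_sub_C _]
    simp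
  · intro i hi
    rw [Finset.mem_Ioo] at hi
    have hz := hxz ⟨m - i, by omega⟩
    rw [← hrx, root_iff] at hz
    have hmi : m - (m - i) = i := by omega
    simp only [hmi] at hz
    refine ⟨Polynomial.X - Polynomial.C (r (T ⟨m - i, by omega⟩)), ?_, ?_, ?_⟩
    · rw [Polynomial.degree_X_sub_C]; exact zero_lt_one
    · exact Finset.dvd_prod_of_mem (fun k => Polynomial.X - Polynomial.C (r k)) (Finset.mem_univ _)
    · exact Polynomial.dvd_iff_isRoot.2 hz
  · rintro ⟨b, hb⟩
    have hrb : ∀ k, r k = b := by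
      intro k
      have h1 : Polynomial.eval (r k) (∏ k, (Polynomial.X - Polynomial.C (r k))) = 0 := by
        rw [Polynomial.eval_prod]
        exact Finset.prod_eq_zero (Finset.mem_univ k) (by simp)
      rw [hb] at h1
      simp at h1
      exact sub_eq_zero.1 h1
    apply hx
    rw [← hrx]
    ext k
    simp [hrb]

end CasasAux

/-- **Theorem (bad primes via minors).** For `n ≥ 2` and a prime `p`, `p` is a bad prime for `n`
iff `p` divides `J_T` for some tuple `T ∈ {1,…,n}^{n-1}`. -/
theorem badPrime_iff_dvd_minor_gcd (n p : ℕ) (hn : 2 ≤ n) (hp : p.Prime) :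
    IsBadPrime n p ↔ ∃ T : Fin (n - 1) → Fin n, (p : ℤ) ∣ casasJ n T := by
  obtain ⟨m, rfl⟩ : ∃ m, n = m + 1 := ⟨n - 1, by omega⟩
  exact ⟨fun h => CasasAux.bad_imp (by omega) h,
    fun ⟨T, hT⟩ => CasasAux.imp_bad (by omega) hp T hT⟩
end

section
/- Let n ≥ 2, d = (n²−3n+4)/2, C = binom((n²−n)/2, n−2), D = Σ_{i=1}^{n−1} binom(d−i+n−2, n−2). Let (b_1 ≤ b_2 ≤ … ≤ b_D) be the nondecreasing enumeration of the multiset containing binom(i+n−2, n−2) with multiplicity binom(d−i+n−2, n−2) for each i ∈ {1,…,n−1}. Assume that over every algebraically closed field of characteristic 0, every Casas–Alvero polynomial of degree n is an n-th power of a linear polynomial. Then every bad prime p for n satisfies p < C! · ∏_{k=D−C+1}^{D} b_k. -/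
open Polynomial MvPolynomial

/-- The multiset containing `binom(i+n-2, n-2)` with multiplicity `binom(d-i+n-2, n-2)` for each
`i ∈ {1,…,n-1}`. -/
def casasMultiset (n : ℕ) : Multiset ℕ :=
  (Finset.Icc 1 (n - 1)).val.bind fun i =>
    Multiset.replicate (Nat.choose (casasD n - i + n - 2) (n - 2))
      (Nat.choose (i + n - 2) (n - 2))


section macaulay
attribute [local instance] MvPolynomial.gradedAlgebra

/-- The linear form `∑ t^i x_i`. -/
noncomputable def linForm {K : Type} [Field K] (m : ℕ) (t : K) : MvPolynomial (Fin m) K :=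
  ∑ i : Fin m, MvPolynomial.C (t ^ (i : ℕ)) * MvPolynomial.X i

lemma linForm_homog {K : Type} [Field K] (m : ℕ) (t : K) : (linForm m t).IsHomogeneous 1 :=
  IsHomogeneous.sum _ _ _ fun i _ => isHomogeneous_C_mul_X _ i

lemma linForm_finite {K : Type} [Field K] (m : ℕ) (P : Ideal (MvPolynomial (Fin m) K))
    (hP : ∃ i, MvPolynomial.X i ∉ P) : {t : K | linForm m t ∈ P}.Finite := by
  classical
  let V : Submodule K (Fin m → K) :=
    { carrier := {c | ∑ i, MvPolynomial.C (c i) * MvPolynomial.X i ∈ P}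
      add_mem' := by
        intro a b ha hb
        have := P.add_mem ha hb
        rw [← Finset.sum_add_distrib] at this
        simpa [add_mul] using this
      zero_mem' := by simp
      smul_mem' := by
        intro r a ha
        have := P.mul_mem_left (MvPolynomial.C r) ha
        rw [Finset.mul_sum] at this
        simpa [mul_assoc] using this }
  have hVmem : ∀ c : Fin m → K, c ∈ V ↔ ∑ i, MvPolynomial.C (c i) * MvPolynomial.X i ∈ P :=
    fun _ => Iff.rfl
  have hV : V < ⊤ := by
    rw [lt_top_iff_ne_top]
    intro h
    obtain ⟨i, hi⟩ := hP
    apply hi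
    have h1 : (Pi.single i (1 : K) : Fin m → K) ∈ V := by rw [h]; exact Submodule.mem_top
    have this := (hVmem _).1 h1
    rw [Finset.sum_eq_single i] at this
    · simpa using this
    · intro j _ hj
      simp [Pi.single_eq_of_ne hj]
    · simp
  obtain ⟨f, hf0, hf⟩ := Submodule.exists_le_ker_of_lt_top V hV
  let q : K[X] := ∑ i : Fin m, Polynomial.C (f (Pi.single i 1)) * Polynomial.X ^ (i : ℕ)
  have hfe : ∀ c : Fin m → K, f c = ∑ i, c i * f (Pi.single i 1) := by
    intro c
    rw [LinearMap.pi_apply_eq_sum_univ f c]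
    refine Finset.sum_congr rfl fun i _ => ?_
    rw [smul_eq_mul]
    congr 2
    ext j
    simp [Pi.single_apply, eq_comm]
  have hq : q ≠ 0 := by
    intro h
    apply hf0
    ext c
    have hc : f (Pi.single c 1) = q.coeff c := by
      simp only [q, Polynomial.finsetSum_coeff, Polynomial.coeff_C_mul_X_pow]
      rw [Finset.sum_eq_single c]
      · simp
      · intro j _ hj
        rw [if_neg]
        intro h'
        exact hj (Fin.ext h'.symm)
      · simp
    simp [hc, h]
  refine (q.roots.toFinset.finite_toSet).subset ?_
  intro t ht
  have h1 : (fun i : Fin m => t ^ (i : ℕ)) ∈ V := (hVmem _).2 ht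
  have h2 := hf h1
  rw [LinearMap.mem_ker, hfe] at h2
  simp only [Finset.mem_coe, Multiset.mem_toFinset, Polynomial.mem_roots hq, Polynomial.IsRoot.def]
  rw [← h2]
  simp only [q, Polynomial.eval_finsetSum]
  refine Finset.sum_congr rfl fun i _ => ?_
  rw [Polynomial.eval_mul, Polynomial.eval_C, Polynomial.eval_pow, Polynomial.eval_X, mul_comm]

lemma exists_linForm {K : Type} [Field K] [Infinite K] (m : ℕ)
    (I : Ideal (MvPolynomial (Fin m) K)) (hI : I.IsHomogeneous (homogeneousSubmodule (Fin m) K))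
    (g : MvPolynomial (Fin m) K) (hg : MvPolynomial.constantCoeff g = 0)
    (h : ∀ i, MvPolynomial.X i ∈ (I ⊔ Ideal.span {g}).radical) :
    ∃ t : K, ∀ i, MvPolynomial.X i ∈ (I ⊔ Ideal.span {linForm m t}).radical := by
  classical
  set 𝔪 : Ideal (MvPolynomial (Fin m) K) := RingHom.ker MvPolynomial.constantCoeff with h𝔪
  have h𝔪p : 𝔪.IsPrime := RingHom.ker_isPrime _
  have h𝔪le : ∀ Q : Ideal (MvPolynomial (Fin m) K), (∀ i, MvPolynomial.X i ∈ Q) → 𝔪 ≤ Q := by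
    intro Q hQ f hf
    rw [f.as_sum]
    refine Q.sum_mem fun a ha => ?_
    have ha0 : a ≠ 0 := by
      rintro rfl
      rw [MvPolynomial.mem_support_iff] at ha
      exact ha hf
    obtain ⟨i, hi⟩ := Finsupp.ne_iff.1 ha0
    have : MvPolynomial.X i ∣ MvPolynomial.monomial a (f.coeff a) := by
      rw [MvPolynomial.X_dvd_monomial]
      right; simpa using hi
    exact Q.mem_of_dvd this (hQ i)
  have hhom : ∀ Q : Ideal (MvPolynomial (Fin m) K), Q.IsPrime →
      Q.IsHomogeneous (homogeneousSubmodule (Fin m) K) → Q ≤ 𝔪 := by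
    intro Q hQ hQh f hf
    have h0 := homogeneousComponent_mem_of_mem hQh hf 0
    rw [homogeneousComponent_zero] at h0
    by_contra hne
    apply hQ.ne_top
    refine Ideal.eq_top_of_isUnit_mem _ h0 ?_
    have : f.coeff 0 ≠ 0 := hne
    exact (IsUnit.mk0 _ this).map MvPolynomial.C
  have hfin : (⋃ P ∈ {P ∈ I.minimalPrimes | ∃ i, MvPolynomial.X i ∉ P},
      {t : K | linForm m t ∈ P}).Finite := by
    refine Set.Finite.biUnion ?_ ?_
    · exact (Ideal.finite_minimalPrimes_of_isNoetherianRing _ I).subset (Set.sep_subset _ _)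
    · rintro P ⟨_, hP⟩
      exact linForm_finite m P hP
  obtain ⟨t, ht⟩ := hfin.exists_notMem
  refine ⟨t, fun i => ?_⟩
  have hy : (I ⊔ Ideal.span {linForm m t}).IsHomogeneous (homogeneousSubmodule (Fin m) K) := by
    refine hI.sup (Ideal.homogeneous_span _ _ ?_)
    intro x hx
    rw [Set.mem_singleton_iff.1 hx]
    exact ⟨1, linForm_homog m t⟩
  rw [hy.radical_eq, Ideal.mem_sInf]
  rintro Q ⟨hQh, hQI, hQ⟩
  obtain ⟨P, hP, hPQ⟩ := Ideal.exists_minimalPrimes_le (le_sup_left.trans hQI)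
  have hPp : P.IsPrime := hP.1.1
  by_cases hX : ∃ i, MvPolynomial.X i ∉ P
  · have hyP : linForm m t ∉ P := by
      intro hh
      exact ht (Set.mem_biUnion (x := P) ⟨hP, hX⟩ hh)
    have hPltQ : P < Q := by
      refine lt_of_le_of_ne hPQ ?_
      rintro rfl
      exact hyP (hQI (Ideal.mem_sup_right (Ideal.mem_span_singleton_self _)))
    have hQm := hhom Q hQ hQh
    by_contra hcon
    have hQltm : Q < 𝔪 := by
      refine lt_of_le_of_ne hQm ?_
      rintro h'
      apply hcon
      rw [h', h𝔪, RingHom.mem_ker]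
      simp
    have hmin : 𝔪 ∈ (P ⊔ Ideal.span {g}).minimalPrimes := by
      refine ⟨⟨h𝔪p, sup_le (hPQ.trans hQm) ?_⟩, ?_⟩
      · rw [Ideal.span_singleton_le_iff_mem]; exact hg
      · rintro P' ⟨hP'p, hP'⟩ _
        refine h𝔪le _ fun j => ?_
        have := h j
        exact (hP'p.radical_le_iff.2 ((sup_le_sup_right hP.1.2 _).trans hP')) this
    have hht := Ideal.map_height_le_one_of_mem_minimalPrimes hmin
    have hsurj : Function.Surjective (Ideal.Quotient.mk P) := Ideal.Quotient.mk_surjective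
    have hQ' : (Q.map (Ideal.Quotient.mk P)).IsPrime :=
      Ideal.map_isPrime_of_surjective hsurj (by rw [Ideal.mk_ker]; exact hPQ)
    have hm' : (𝔪.map (Ideal.Quotient.mk P)).IsPrime :=
      Ideal.map_isPrime_of_surjective hsurj (by rw [Ideal.mk_ker]; exact hPQ.trans hQm)
    have hb : (⊥ : Ideal (MvPolynomial (Fin m) K ⧸ P)).IsPrime := Ideal.isPrime_bot
    have c1 : ∀ J : Ideal (MvPolynomial (Fin m) K), P ≤ J →
        (J.map (Ideal.Quotient.mk P)).comap (Ideal.Quotient.mk P) = J := by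
      intro J hJ
      rw [Ideal.comap_map_of_surjective _ hsurj, ← RingHom.ker_eq_comap_bot, Ideal.mk_ker]
      exact sup_eq_left.2 hJ
    have l1 : (⊥ : Ideal (MvPolynomial (Fin m) K ⧸ P)) < Q.map (Ideal.Quotient.mk P) := by
      rw [bot_lt_iff_ne_bot]
      intro h'
      rw [Ideal.map_eq_bot_iff_le_ker, Ideal.mk_ker] at h'
      exact absurd hPltQ (not_lt_of_ge h')
    have l2 : Q.map (Ideal.Quotient.mk P) < 𝔪.map (Ideal.Quotient.mk P) := by
      refine lt_of_le_of_ne (Ideal.map_mono hQm) ?_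
      intro h'
      have := congrArg (Ideal.comap (Ideal.Quotient.mk P)) h'
      rw [c1 _ hPQ, c1 _ (hPQ.trans hQm)] at this
      exact hQltm.ne this
    have fin1 : Ideal.FiniteHeight (Q.map (Ideal.Quotient.mk P)) := inferInstance
    have e1 := Ideal.height_strict_mono_of_isPrime_of_isPrime l1
    have e2 := Ideal.height_strict_mono_of_isPrime_of_isPrime l2
    have e3 : (1 : ℕ∞) ≤ (Q.map (Ideal.Quotient.mk P)).height := by
      exact Order.one_le_iff_pos.2 (lt_of_le_of_lt (zero_le) e1)
    exact absurd (lt_of_le_of_lt e3 (lt_of_lt_of_le e2 hht)) (lt_irrefl _)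
  · push Not at hX
    exact hPQ (hX i)

/-- restriction to the hyperplane `linForm t = 0`. -/
noncomputable def restr {K : Type} [Field K] (m : ℕ) (t : K) :
    MvPolynomial (Fin (m + 1)) K →ₐ[K] MvPolynomial (Fin m) K :=
  MvPolynomial.aeval (Fin.cons (-∑ i : Fin m, MvPolynomial.C (t ^ ((i : ℕ) + 1)) * MvPolynomial.X i)
    (fun i => MvPolynomial.X i))

lemma restr_surj {K : Type} [Field K] (m : ℕ) (t : K) : Function.Surjective (restr m t) := by
  intro f
  refine ⟨MvPolynomial.rename Fin.succ f, ?_⟩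
  rw [restr, MvPolynomial.aeval_rename]
  have : (Fin.cons (-∑ i : Fin m, MvPolynomial.C (t ^ ((i : ℕ) + 1)) * MvPolynomial.X i)
    (fun i => MvPolynomial.X i) : Fin (m + 1) → MvPolynomial (Fin m) K) ∘ Fin.succ
      = MvPolynomial.X := by
    ext1 i; simp
  rw [this]; simp

lemma restr_linForm {K : Type} [Field K] (m : ℕ) (t : K) : restr m t (linForm (m + 1) t) = 0 := by
  simp only [restr, linForm, Fin.sum_univ_succ]
  simp [MvPolynomial.algebraMap_eq]

lemma restr_ker {K : Type} [Field K] (m : ℕ) (t : K) (f : MvPolynomial (Fin (m + 1)) K)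
    (hf : restr m t f = 0) : f ∈ Ideal.span {linForm (m + 1) t} := by
  have key : ((Ideal.Quotient.mkₐ K (Ideal.span {linForm (m + 1) t})).comp
      (MvPolynomial.rename Fin.succ)).comp (restr m t) =
      Ideal.Quotient.mkₐ K (Ideal.span {linForm (m + 1) t}) := by
    apply MvPolynomial.algHom_ext
    intro i
    refine Fin.cases ?_ (fun i => ?_) i
    · simp only [AlgHom.comp_apply, restr, MvPolynomial.aeval_X, Fin.cons_zero,
        Ideal.Quotient.mkₐ_eq_mk]
      rw [Ideal.Quotient.eq, Ideal.mem_span_singleton]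
      refine ⟨-1, ?_⟩
      simp only [linForm, Fin.sum_univ_succ]
      simp
      ring
    · simp [AlgHom.comp_apply, restr]
  have h2 := DFunLike.congr_fun key f
  rw [AlgHom.comp_apply, hf, map_zero] at h2
  exact Ideal.Quotient.eq_zero_iff_mem.1 h2.symm

lemma restr_homog {K : Type} [Field K] (m : ℕ) (t : K) (f : MvPolynomial (Fin (m + 1)) K) (e : ℕ)
    (hf : f.IsHomogeneous e) : (restr m t f).IsHomogeneous e := by
  have := hf.aeval (S := K) (τ := Fin m) (Fin.cons (-∑ i : Fin m, MvPolynomial.C (t ^ ((i : ℕ) + 1)) * MvPolynomial.X i)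
    (fun i => MvPolynomial.X i)) (n := 1) (by
      intro i
      refine Fin.cases ?_ (fun i => ?_) i
      · rw [Fin.cons_zero]
        exact (IsHomogeneous.sum _ _ _ fun i _ => isHomogeneous_C_mul_X _ i).neg
      · rw [Fin.cons_succ]
        exact isHomogeneous_X _ _)
  simpa [restr] using this

lemma mem_of_restr_mem {K : Type} [Field K] (m : ℕ) (t : K) (f : MvPolynomial (Fin (m + 1)) K)
    (J : Ideal (MvPolynomial (Fin (m + 1)) K)) (h : restr m t f ∈ J.map (restr m t)) :
    ∃ c, f - linForm (m + 1) t * c ∈ J := by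
  have h1 : f ∈ (J.map (restr m t)).comap (restr m t) := h
  rw [Ideal.comap_map_of_surjective _ (restr_surj m t)] at h1
  obtain ⟨a, ha, b, hb, hab⟩ := Submodule.mem_sup.1 h1
  have hb' := restr_ker m t b hb
  obtain ⟨c, rfl⟩ := Ideal.mem_span_singleton.1 hb'
  exact ⟨c, by rw [← hab]; simpa using ha⟩

lemma homogComp_mul {K σ : Type} [Field K] (g a : MvPolynomial σ K) (d e : ℕ)
    (hg : g.IsHomogeneous d) :
    homogeneousComponent (d + e) (g * a) = g * homogeneousComponent e a := by
  classical
  conv_lhs => rw [← sum_homogeneousComponent a, Finset.mul_sum, map_sum]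
  have : ∀ i ∈ Finset.range (a.totalDegree + 1),
      homogeneousComponent (d + e) (g * homogeneousComponent i a)
        = if i = e then g * homogeneousComponent e a else 0 := by
    intro i _
    have hm : (g * homogeneousComponent i a).IsHomogeneous (d + i) :=
      hg.mul (homogeneousComponent_isHomogeneous i a)
    rw [homogeneousComponent_of_mem hm]
    by_cases h : i = e
    · simp [h]
    · rw [if_neg h, if_neg (by omega)]
  rw [Finset.sum_congr rfl this, Finset.sum_ite_eq']
  split_ifs with h
  · rfl
  · rw [homogeneousComponent_eq_zero, mul_zero]
    simp at h; omega

lemma homogComp_mul_lt {K σ : Type} [Field K] (g a : MvPolynomial σ K) (d e : ℕ)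
    (hg : g.IsHomogeneous d) (h : e < d) :
    homogeneousComponent e (g * a) = 0 := by
  classical
  rw [← sum_homogeneousComponent a, Finset.mul_sum, map_sum]
  refine Finset.sum_eq_zero fun i _ => ?_
  have hm : (g * homogeneousComponent i a).IsHomogeneous (d + i) :=
    hg.mul (homogeneousComponent_isHomogeneous i a)
  rw [homogeneousComponent_of_mem hm, if_neg (by omega)]

lemma span_homog {K σ ι : Type} [Field K] (u : ι → MvPolynomial σ K) (d : ι → ℕ)
    (hu : ∀ i, (u i).IsHomogeneous (d i)) (S : Set ι) :
    (Ideal.span (u '' S)).IsHomogeneous (homogeneousSubmodule σ K) := by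
  apply Ideal.homogeneous_span
  rintro _ ⟨i, _, rfl⟩
  exact ⟨d i, hu i⟩

/-- Division step: a homogeneous `f` in `J + (y)`. -/
lemma homog_div {K σ : Type} [Field K] (J : Ideal (MvPolynomial σ K))
    (hJ : J.IsHomogeneous (homogeneousSubmodule σ K)) (y f c : MvPolynomial σ K)
    (hy : y.IsHomogeneous 1) (e : ℕ) (hf : f.IsHomogeneous e) (h : f - y * c ∈ J) :
    f ∈ J ∨ ∃ e' c', e = e' + 1 ∧ c'.IsHomogeneous e' ∧ f - y * c' ∈ J := by
  have h1 := homogeneousComponent_mem_of_mem hJ h e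
  rw [map_sub, homogeneousComponent_eq_self hf] at h1
  cases e with
  | zero =>
    left
    rwa [homogComp_mul_lt y c 1 0 hy (by omega), sub_zero] at h1
  | succ e =>
    right
    refine ⟨e, homogeneousComponent e c, rfl, homogeneousComponent_isHomogeneous _ _, ?_⟩
    rwa [add_comm e 1, homogComp_mul y c 1 e hy] at h1

lemma mul_reg_of_homog {K σ : Type} [Field K] (J : Ideal (MvPolynomial σ K))
    (hJ : J.IsHomogeneous (homogeneousSubmodule σ K)) (g : MvPolynomial σ K) (d : ℕ)
    (hg : g.IsHomogeneous d)
    (h : ∀ e c, c.IsHomogeneous e → g * c ∈ J → c ∈ J) (c) (hc : g * c ∈ J) : c ∈ J := by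
  rw [mem_iff_homogeneousComponent_mem hJ]
  intro n
  refine h n _ (homogeneousComponent_isHomogeneous _ _) ?_
  rw [← homogComp_mul g c d n hg]
  exact homogeneousComponent_mem_of_mem hJ hc _

set_option maxHeartbeats 2000000 in
theorem macaulay_aux {K : Type} [Field K] [Infinite K] : ∀ (m : ℕ)
    (G : Fin m → MvPolynomial (Fin m) K) (d : Fin m → ℕ)
    (_ : ∀ i, (G i).IsHomogeneous (d i)) (_ : ∀ i, 0 < d i)
    (_ : ∀ i, MvPolynomial.X i ∈ (Ideal.span (Set.range G)).radical),
    (∀ j : Fin m, ∀ c, G j * c ∈ Ideal.span (G '' {i | i < j}) →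
      c ∈ Ideal.span (G '' {i | i < j})) ∧
    (∀ e h, h.IsHomogeneous e → ∑ i, d i < e + m → h ∈ Ideal.span (Set.range G)) := by
  intro m
  induction m with
  | zero =>
    intro G d _ _ _
    refine ⟨fun j => j.elim0, fun e h hh he => ?_⟩
    have h0 := isHomogeneous_of_isEmpty (R := K) (f := h)
    by_cases hz : h = 0
    · rw [hz]; exact Ideal.zero_mem _
    · have := hh.inj_right h0 hz
      simp at he; omega
  | succ m ih =>
    intro G d hG hd hX
    set u : Fin m → MvPolynomial (Fin (m + 1)) K := fun i => G i.castSucc with hu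
    set g := G (Fin.last m) with hg
    set J := Ideal.span (Set.range u) with hJ
    have hJ' : J = Ideal.span (u '' Set.univ) := by rw [hJ, Set.image_univ]
    have huh : ∀ i, (u i).IsHomogeneous (d i.castSucc) := fun i => hG _
    have hJh : J.IsHomogeneous (homogeneousSubmodule (Fin (m + 1)) K) := by
      rw [hJ']; exact span_homog u _ huh _
    have hrange : Set.range G = Set.range u ∪ {g} := by
      ext x
      simp only [Set.mem_range, Set.mem_union, Set.mem_singleton_iff, hu, hg]
      constructor
      · rintro ⟨i, rfl⟩
        refine Fin.lastCases ?_ (fun i => ?_) i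
        · right; rfl
        · left; exact ⟨i, rfl⟩
      · rintro (⟨i, rfl⟩ | rfl)
        · exact ⟨_, rfl⟩
        · exact ⟨_, rfl⟩
    have hsup : Ideal.span (Set.range G) = J ⊔ Ideal.span {g} := by
      rw [hrange, Ideal.span_union]
    have hgc : MvPolynomial.constantCoeff g = 0 := by
      rw [MvPolynomial.constantCoeff_eq]
      apply (hG (Fin.last m)).coeff_eq_zero
      have := hd (Fin.last m)
      simp; omega
    obtain ⟨t, ht⟩ := exists_linForm (m + 1) J hJh g hgc (by rw [← hsup]; exact hX)
    set y := linForm (m + 1) t with hy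
    have hyh : y.IsHomogeneous 1 := linForm_homog _ _
    have hmapS : ∀ S : Set (Fin m), Ideal.map (restr m t) (Ideal.span (u '' S))
        = Ideal.span ((fun i => restr m t (u i)) '' S) := by
      intro S
      rw [Ideal.map_span, Set.image_image]
    have hmapJ : Ideal.map (restr m t) J = Ideal.span (Set.range fun i => restr m t (u i)) := by
      rw [hJ', hmapS, Set.image_univ]
    obtain ⟨ihB, ihT⟩ := ih (fun i => restr m t (u i)) (fun i => d i.castSucc)
      (fun i => restr_homog _ _ _ _ (huh i)) (fun i => hd _) (by
        intro i
        obtain ⟨k, hk⟩ := ht i.succ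
        refine ⟨k, ?_⟩
        have h1 := Ideal.mem_map_of_mem (restr m t) hk
        rw [Ideal.map_sup, hmapJ, Ideal.map_span, Set.image_singleton, restr_linForm] at h1
        simpa [restr] using h1)
    -- initial segments
    let Jk : ℕ → Ideal (MvPolynomial (Fin (m + 1)) K) := fun k =>
      Ideal.span (u '' {i | (i : ℕ) < k})
    have hJkh : ∀ k, (Jk k).IsHomogeneous (homogeneousSubmodule (Fin (m + 1)) K) := fun k =>
      span_homog u _ huh _
    have hJkm : Jk m = J := by
      have h0 : {i : Fin m | (i : ℕ) < m} = Set.univ := by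
        ext i; simp
      simp only [Jk]
      rw [hJ', h0]
    have hJks : ∀ k (hk : k < m), Jk (k + 1) = Jk k ⊔ Ideal.span {u ⟨k, hk⟩} := by
      intro k hk
      simp only [Jk]
      have h0 : {i : Fin m | (i : ℕ) < k + 1} = {i : Fin m | (i : ℕ) < k} ∪ {⟨k, hk⟩} := by
        ext i
        simp [Fin.ext_iff]; omega
      rw [h0, Set.image_union, Set.image_singleton, Ideal.span_union]
    have ihB' : ∀ k (hk : k < m), ∀ c, ∀ w, u ⟨k, hk⟩ * c - y * w ∈ Jk k →
        ∃ c', c - y * c' ∈ Jk k := by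
      intro k hk c w hw
      apply mem_of_restr_mem
      have h1 := Ideal.mem_map_of_mem (restr m t) hw
      have hset : Jk k = Ideal.span (u '' {i | i < (⟨k, hk⟩ : Fin m)}) := rfl
      rw [hset, hmapS] at h1 ⊢
      apply ihB ⟨k, hk⟩
      rw [map_sub, map_mul, map_mul, restr_linForm, zero_mul, sub_zero] at h1
      exact h1
    have A : ∀ k, k ≤ m → ∀ c, y * c ∈ Jk k → c ∈ Jk k := by
      intro k
      induction k with
      | zero =>
        intro _ c hc
        have h0 : Jk 0 = ⊥ := by simp [Jk]
        rw [h0, Ideal.mem_bot] at hc ⊢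
        have hy0 : y ≠ 0 := by
          intro h0
          have h1 : y.coeff (Finsupp.single 0 1) = 1 := by
            rw [hy, linForm, MvPolynomial.coeff_sum, Finset.sum_eq_single 0]
            · simp
            · intro b _ hb
              rw [MvPolynomial.coeff_C_mul, MvPolynomial.coeff_X, if_neg, mul_zero]
              intro h
              exact hb (Finsupp.single_left_injective one_ne_zero h)
            · simp
          rw [h0] at h1
          simp at h1
        exact (mul_eq_zero.1 hc).resolve_left hy0
      | succ k ihk =>
        intro hk c hc
        rw [hJks k hk] at hc ⊢
        obtain ⟨a, ha, b, hb, hab⟩ := Submodule.mem_sup.1 hc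
        obtain ⟨b', rfl⟩ := Ideal.mem_span_singleton.1 hb
        obtain ⟨c', hc'⟩ := ihB' k hk b' c (by
          have : u ⟨k, hk⟩ * b' - y * c = -a := by rw [← hab]; ring
          rw [this]; exact neg_mem ha)
        have h2 : y * (c - u ⟨k, hk⟩ * c') ∈ Jk k := by
          have : y * (c - u ⟨k, hk⟩ * c') = a + u ⟨k, hk⟩ * (b' - y * c') := by
            rw [mul_sub, ← hab]; ring
          rw [this]
          exact add_mem ha (Ideal.mul_mem_left _ _ hc')
        have h3 := ihk (by omega) _ h2
        have : c = (c - u ⟨k, hk⟩ * c') + u ⟨k, hk⟩ * c' := by ring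
        rw [this]
        exact Submodule.add_mem_sup h3 (Ideal.mem_span_singleton.2 ⟨c', rfl⟩)
    have AJ : ∀ s c, y ^ s * c ∈ J → c ∈ J := by
      intro s
      induction s with
      | zero => intro c hc; simpa using hc
      | succ s ihs =>
        intro c hc
        apply ihs
        rw [← hJkm]
        apply A m le_rfl
        rw [hJkm]
        convert hc using 1
        ring
    -- exchange
    obtain ⟨s, hs, a, ha, hag⟩ : ∃ s, d (Fin.last m) ≤ s ∧ ∃ a, a.IsHomogeneous (s - d (Fin.last m)) ∧
        y ^ s - g * a ∈ J := by
      have hyr : y ∈ (J ⊔ Ideal.span {g}).radical := by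
        rw [← hsup, hy, linForm]
        exact Ideal.sum_mem _ fun i _ => Ideal.mul_mem_left _ _ (hX i)
      obtain ⟨k, hk⟩ := hyr
      have hk' : y ^ (d (Fin.last m) + k) ∈ J ⊔ Ideal.span {g} := by
        rw [pow_add]; exact Ideal.mul_mem_left _ _ hk
      refine ⟨d (Fin.last m) + k, by omega, ?_⟩
      obtain ⟨w, hw, b, hb, hwb⟩ := Submodule.mem_sup.1 hk'
      obtain ⟨a, rfl⟩ := Ideal.mem_span_singleton.1 hb
      refine ⟨homogeneousComponent k a, ?_, ?_⟩
      · rw [Nat.add_sub_cancel_left]; exact homogeneousComponent_isHomogeneous _ _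
      · have h1 := homogeneousComponent_mem_of_mem hJh hw (d (Fin.last m) + k)
        have h2 : w = y ^ (d (Fin.last m) + k) - g * a := by rw [← hwb]; ring
        rw [h2, map_sub, homogComp_mul g a _ _ (hG _), homogeneousComponent_eq_self] at h1
        · exact h1
        · simpa using hyh.pow (d (Fin.last m) + k)
    have areg : ∀ c, a * c ∈ J → c ∈ J := by
      intro c hc
      apply AJ s
      have : y ^ s * c = (y ^ s - g * a) * c + g * (a * c) := by ring
      rw [this]
      exact add_mem (Ideal.mul_mem_right _ _ hag) (Ideal.mul_mem_left _ _ hc)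
    have greg : ∀ c, g * c ∈ J → c ∈ J := by
      intro c hc
      apply AJ s
      have : y ^ s * c = (y ^ s - g * a) * c + a * (g * c) := by ring
      rw [this]
      exact add_mem (Ideal.mul_mem_right _ _ hag) (Ideal.mul_mem_left _ _ hc)
    constructor
    · intro j
      refine Fin.lastCases ?_ (fun j => ?_) j
      · have hset : G '' {i | i < Fin.last m} = Set.range u := by
          ext x
          constructor
          · rintro ⟨i, hi, rfl⟩
            exact ⟨i.castPred (Fin.ne_of_lt hi), by simp [hu]⟩
          · rintro ⟨i, rfl⟩
            exact ⟨i.castSucc, Fin.castSucc_lt_last i, rfl⟩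
        rw [hset]
        exact greg
      · have hset : G '' {i | i < j.castSucc} = u '' {i | (i : ℕ) < j} := by
          ext x
          constructor
          · rintro ⟨i, hi, rfl⟩
            have hi' : (i : ℕ) < j := hi
            refine ⟨⟨i, by omega⟩, hi', rfl⟩
          · rintro ⟨i, hi, rfl⟩
            exact ⟨i.castSucc, hi, rfl⟩
        rw [hset]
        change ∀ c, u j * c ∈ Jk j → c ∈ Jk j
        apply mul_reg_of_homog _ (hJkh _) _ _ (huh j)
        intro e
        induction e using Nat.strong_induction_on with
        | _ e ihe =>
          intro c hce hc
          obtain ⟨c', hc'⟩ := ihB' j j.2 c 0 (by simpa using hc)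
          rcases homog_div _ (hJkh j) y c c' hyh e hce hc' with h | ⟨e', c'', he, hce', h⟩
          · exact h
          · have h2 : c'' ∈ Jk j := by
              apply ihe e' (by omega) _ hce'
              apply A j j.2.le
              have : y * (u j * c'') = u j * c - u j * (c - y * c'') := by ring
              rw [this]
              exact sub_mem hc (Ideal.mul_mem_left _ _ h)
            have : c = (c - y * c'') + y * c'' := by ring
            rw [this]
            exact add_mem h (Ideal.mul_mem_left _ _ h2)
    · have pw : ∀ s e h, h.IsHomogeneous e → ∑ i : Fin m, d i.castSucc + s < e + m + 1 →
          ∃ c, h - y ^ s * c ∈ J := by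
        intro s
        induction s with
        | zero => intro e h _ _; exact ⟨h, by simp⟩
        | succ s ihs =>
          intro e h hh he
          obtain ⟨c, hc⟩ := mem_of_restr_mem m t h J (by
            rw [hmapJ]
            exact ihT e _ (restr_homog _ _ _ _ hh) (by omega))
          rcases homog_div _ hJh y h c hyh e hh hc with h' | ⟨e', c', he', hce', h'⟩
          · exact ⟨0, by simpa using h'⟩
          · obtain ⟨c2, hc2⟩ := ihs e' c' hce' (by omega)
            refine ⟨c2, ?_⟩
            have : h - y ^ (s + 1) * c2 = (h - y * c') + y * (c' - y ^ s * c2) := by ring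
            rw [this]
            exact add_mem h' (Ideal.mul_mem_left _ _ hc2)
      intro e h hh he
      rw [Fin.sum_univ_castSucc] at he
      obtain ⟨c, hc⟩ := pw s _ (a * h) (ha.mul hh) (by omega)
      have h1 : a * (h - g * c) ∈ J := by
        have : a * (h - g * c) = (a * h - y ^ s * c) + (y ^ s - g * a) * c := by ring
        rw [this]
        exact add_mem hc (Ideal.mul_mem_right _ _ hag)
      have h2 := areg _ h1
      rw [hsup]
      have : h = (h - g * c) + g * c := by ring
      rw [this]
      exact Submodule.add_mem_sup h2 (Ideal.mem_span_singleton.2 ⟨c, rfl⟩)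
end macaulay

section forms

/-- `(0, x_1, …, x_m)`. -/
noncomputable def xhat (R : Type) [CommRing R] (m : ℕ) : Fin (m + 1) → MvPolynomial (Fin m) R :=
  Fin.cons 0 (fun i => MvPolynomial.X i)

/-- The nonzero differences with the `j`-th root. -/
noncomputable def qform (R : Type) [CommRing R] (m : ℕ) (j : Fin (m + 1)) (l : Fin m) :
    MvPolynomial (Fin m) R :=
  xhat R m (Equiv.swap 0 j l.succ) - xhat R m j

/-- The elementary symmetric polynomial in the differences. -/
noncomputable def gform (R : Type) [CommRing R] (m : ℕ) (j : Fin (m + 1)) (k : ℕ) :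
    MvPolynomial (Fin m) R :=
  ∑ S ∈ Finset.powersetCard k (Finset.univ : Finset (Fin m)), ∏ l ∈ S, qform R m j l

lemma xhat_homog (R : Type) [CommRing R] (m : ℕ) (j : Fin (m + 1)) :
    (xhat R m j).IsHomogeneous 1 := by
  refine Fin.cases ?_ (fun j => ?_) j
  · rw [xhat, Fin.cons_zero]; exact isHomogeneous_zero _ _ _
  · rw [xhat, Fin.cons_succ]; exact isHomogeneous_X _ _

lemma gform_homog (R : Type) [CommRing R] (m : ℕ) (j : Fin (m + 1)) (k : ℕ) :
    (gform R m j k).IsHomogeneous k := by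
  refine IsHomogeneous.sum _ _ _ fun S hS => ?_
  have := IsHomogeneous.prod S (fun l => qform R m j l) (fun _ => 1)
    (fun l _ => (xhat_homog R m _).sub (xhat_homog R m _))
  simpa [(Finset.mem_powersetCard.1 hS).2] using this

lemma xhat_map {R S : Type} [CommRing R] [CommRing S] (f : R →+* S) (m : ℕ) (j : Fin (m + 1)) :
    MvPolynomial.map f (xhat R m j) = xhat S m j := by
  refine Fin.cases ?_ (fun j => ?_) j <;> simp [xhat]

lemma gform_map {R S : Type} [CommRing R] [CommRing S] (f : R →+* S) (m : ℕ) (j : Fin (m + 1))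
    (k : ℕ) : MvPolynomial.map f (gform R m j k) = gform S m j k := by
  simp [gform, qform, xhat_map]

lemma xhat_eval {R : Type} [CommRing R] (m : ℕ) (r : Fin (m + 1) → R) (j : Fin (m + 1)) :
    MvPolynomial.eval (fun l : Fin m => r l.succ - r 0) (xhat R m j) = r j - r 0 := by
  refine Fin.cases ?_ (fun j => ?_) j <;> simp [xhat]

lemma gform_eval {R : Type} [CommRing R] (m : ℕ) (r : Fin (m + 1) → R) (j : Fin (m + 1))
    (k : ℕ) : MvPolynomial.eval (fun l : Fin m => r l.succ - r 0) (gform R m j k) =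
      ∑ S ∈ Finset.powersetCard k (Finset.univ : Finset (Fin m)),
        ∏ l ∈ S, (r (Equiv.swap 0 j l.succ) - r j) := by
  simp [gform, qform, xhat_eval]

lemma hasse_eval {K : Type} [Field K] (m : ℕ) (r : Fin (m + 1) → K) (j : Fin (m + 1))
    (k : ℕ) (hk : k ≤ m) :
    (Polynomial.hasseDeriv (m + 1 - k) (∏ l, (Polynomial.X - Polynomial.C (r l)))).eval (r j) =
      (-1) ^ k * MvPolynomial.eval (fun l : Fin m => r l.succ - r 0) (gform K m j k) := by
  rw [← Polynomial.taylor_coeff, gform_eval]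
  have h1 : Polynomial.taylor (r j) (∏ l, (Polynomial.X - Polynomial.C (r l)))
      = Polynomial.X * ∏ l : Fin m,
        (Polynomial.X - Polynomial.C (r (Equiv.swap 0 j l.succ) - r j)) := by
    rw [← Equiv.prod_comp (Equiv.swap 0 j), Fin.prod_univ_succ]
    rw [Polynomial.taylor_apply, Polynomial.mul_comp, Polynomial.prod_comp]
    congr 1
    · simp
    · refine Finset.prod_congr rfl fun l _ => ?_
      simp; ring
  have h2 : m + 1 - k = (m - k) + 1 := by omega
  rw [h1, h2, Polynomial.coeff_X_mul]
  have h3 := Multiset.prod_X_sub_C_coeff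
    ((Finset.univ : Finset (Fin m)).val.map (fun l => r (Equiv.swap 0 j l.succ) - r j))
    (k := m - k) (by simp)
  rw [Multiset.map_map] at h3
  simp only [Multiset.card_map, Finset.card_val, Finset.card_univ, Fintype.card_fin] at h3
  rw [show m - (m - k) = k by omega, Finset.esymm_map_val] at h3
  exact h3

lemma ca_to_zero {K : Type} [Field K] [IsAlgClosed K] (m : ℕ) (f : K[X])
    (hf : IsCasasAlvero (m + 1) f) (hnot : ¬ ∃ b : K, f = (Polynomial.X - Polynomial.C b) ^ (m + 1)) :
    ∃ (T : Fin m → Fin (m + 1)) (x : Fin m → K), x ≠ 0 ∧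
      ∀ i : Fin m, MvPolynomial.eval x (gform K m (T i) (i + 1)) = 0 := by
  obtain ⟨hmon, hdeg, hca⟩ := hf
  have hs := IsAlgClosed.splits f
  have hcard : f.roots.card = m + 1 := by
    rw [← hdeg]; exact hs.natDegree_eq_card_roots.symm
  obtain ⟨r, hr⟩ : ∃ r : Fin (m + 1) → K, f = ∏ l, (Polynomial.X - Polynomial.C (r l)) := by
    have hl : f.roots.toList.length = m + 1 := by rw [Multiset.length_toList, hcard]
    refine ⟨fun i => f.roots.toList.get (i.cast hl.symm), ?_⟩
    have h1 := hs.eq_prod_roots_of_monic hmon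
    conv_lhs => rw [h1, ← Multiset.coe_toList f.roots]
    rw [Multiset.map_coe, Multiset.prod_coe]
    rw [← Fin.prod_ofFn]
    congr 1
    apply List.ext_get
    · simp [hcard]
    · intro n h1 h2
      simp only [List.get_eq_getElem, List.getElem_map, List.getElem_ofFn, Fin.val_cast]
  have hT : ∀ i : Fin m, ∃ j : Fin (m + 1), MvPolynomial.eval (fun l : Fin m => r l.succ - r 0)
      (gform K m j (i + 1)) = 0 := by
    intro i
    obtain ⟨g, hg0, hgf, hgh⟩ := hca (m + 1 - (i + 1)) (by simp)
    obtain ⟨z, hz⟩ := IsAlgClosed.exists_root g hg0.ne'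
    have hzf : f.eval z = 0 := Polynomial.eval_eq_zero_of_dvd_of_eval_eq_zero hgf hz
    have hzh := Polynomial.eval_eq_zero_of_dvd_of_eval_eq_zero hgh hz
    rw [hr, Polynomial.eval_prod, Finset.prod_eq_zero_iff] at hzf
    obtain ⟨j, _, hj⟩ := hzf
    have hzj : z = r j := by simpa [sub_eq_zero] using hj
    refine ⟨j, ?_⟩
    rw [hr, hzj, hasse_eval m r j (i + 1) (by omega)] at hzh
    exact (mul_eq_zero.1 hzh).resolve_left (pow_ne_zero _ (by simp))
  choose T hT using hT
  refine ⟨T, _, ?_, hT⟩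
  intro hx
  apply hnot
  refine ⟨r 0, ?_⟩
  have : ∀ l, r l = r 0 := by
    intro l
    refine Fin.cases rfl (fun l => ?_) l
    have := congrFun hx l
    simpa [sub_eq_zero] using this
  rw [hr]
  simp [this]

lemma zero_of_ca {K : Type} [Field K] (m : ℕ)
    (hCA : ∀ f : K[X], IsCasasAlvero (m + 1) f →
      ∃ b : K, f = (Polynomial.X - Polynomial.C b) ^ (m + 1))
    (T : Fin m → Fin (m + 1)) (x : Fin m → K)
    (hx : ∀ i : Fin m, MvPolynomial.eval x (gform K m (T i) (i + 1)) = 0) : x = 0 := by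
  let r : Fin (m + 1) → K := Fin.cons 0 x
  have hrx : (fun l : Fin m => r l.succ - r 0) = x := by
    ext l; simp [r]
  obtain ⟨b, hb⟩ := hCA (∏ l, (Polynomial.X - Polynomial.C (r l))) (by
    refine ⟨Polynomial.monic_prod_X_sub_C _ _, by simp, ?_⟩
    intro i hi
    rw [Finset.mem_Ioo] at hi
    obtain ⟨k, hk⟩ : ∃ k : Fin m, i = m + 1 - (k + 1) := ⟨⟨m - i, by omega⟩, by simp; omega⟩
    refine ⟨Polynomial.X - Polynomial.C (r (T k)), by simp, ?_, ?_⟩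
    · exact Finset.dvd_prod_of_mem _ (Finset.mem_univ _)
    · rw [Polynomial.dvd_iff_isRoot, Polynomial.IsRoot.def, hk, hasse_eval m r _ _ (by omega), hrx,
        hx k, mul_zero])
  have hrb : ∀ l, r l = b := by
    intro l
    have h1 := congrArg (Polynomial.eval (r l)) hb
    rw [Polynomial.eval_prod, Finset.prod_eq_zero (Finset.mem_univ l) (by simp)] at h1
    simpa [sub_eq_zero] using (pow_eq_zero_iff (Nat.succ_ne_zero m)).1
      (show (r l - b) ^ (m + 1) = 0 by simpa using h1.symm)
  ext l
  have h1 := (hrb l.succ).trans (hrb 0).symm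
  simpa [r] using h1

lemma qprod_coeff (m : ℕ) (j : Fin (m + 1)) (S : Finset (Fin m)) :
    (∀ a : Fin m →₀ ℕ, |(∏ l ∈ S, qform ℤ m j l).coeff a| ≤ 1) ∧
    (∀ a : Fin m →₀ ℕ, ∀ l, l ∉ S → l.succ ≠ j → a l ≠ 0 →
      (∏ l ∈ S, qform ℤ m j l).coeff a = 0) := by
  classical
  induction S using Finset.induction_on with
  | empty =>
    refine ⟨fun a => ?_, fun a l _ _ ha => ?_⟩
    · rw [Finset.prod_empty, MvPolynomial.coeff_one]
      split_ifs <;> simp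
    · rw [Finset.prod_empty, MvPolynomial.coeff_one, if_neg]
      rintro rfl
      simp at ha
  | insert i S hi ih =>
    obtain ⟨ih1, ih2⟩ := ih
    rw [Finset.prod_insert hi]
    set P := ∏ l ∈ S, qform ℤ m j l with hP
    have mx : ∀ (a : Fin m →₀ ℕ) (l : Fin m),
        (P * MvPolynomial.X l).coeff a = if a l ≠ 0 then P.coeff (a - Finsupp.single l 1) else 0 := by
      intro a l
      rw [MvPolynomial.coeff_mul_X']
      simp [Finsupp.mem_support_iff]
    obtain rfl | ⟨j, rfl⟩ := Fin.eq_zero_or_eq_succ j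
    · -- factor is `X i`
      have hq : qform ℤ m 0 i = MvPolynomial.X i := by simp [qform, xhat]
      rw [hq, mul_comm]
      constructor
      · intro a
        rw [mx]
        split_ifs
        · exact ih1 _
        · simp
      · intro a l hl hl0 hal
        rw [Finset.mem_insert, not_or] at hl
        rw [mx]
        split_ifs
        · apply ih2 _ l hl.2 hl0
          simp [Ne.symm hl.1, hal]
        · rfl
    · by_cases hij : i = j
      · have hq : qform ℤ m j.succ i = - MvPolynomial.X j := by simp [qform, xhat, hij]
        have hc : ∀ a, (qform ℤ m j.succ i * P).coeff a = - (P * MvPolynomial.X j).coeff a := by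
          intro a; rw [hq, ← MvPolynomial.coeff_neg]; congr 1; ring
        constructor
        · intro a
          rw [hc, mx, abs_neg]
          split_ifs
          · exact ih1 _
          · simp
        · intro a l hl hl0 hal
          rw [Finset.mem_insert, not_or] at hl
          rw [hc, mx]
          split_ifs
          · rw [ih2 _ l hl.2 hl0, neg_zero]
            have : j ≠ l := fun h => hl0 (by rw [h])
            simp [this, hal]
          · simp
      · have hsw : Equiv.swap 0 j.succ i.succ = i.succ :=
          Equiv.swap_apply_of_ne_of_ne (Fin.succ_ne_zero i) (fun h => hij (Fin.succ_injective _ h))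
        have hq : qform ℤ m j.succ i = MvPolynomial.X i - MvPolynomial.X j := by
          rw [qform, hsw]; simp [xhat]
        have hc : ∀ a, (qform ℤ m j.succ i * P).coeff a =
            (P * MvPolynomial.X i).coeff a - (P * MvPolynomial.X j).coeff a := by
          intro a; rw [hq, ← MvPolynomial.coeff_sub]; congr 1; ring
        have hi0 : i.succ ≠ j.succ := fun h => hij (Fin.succ_injective _ h)
        constructor
        · intro a
          rw [hc, mx, mx]
          by_cases hai : a i = 0
          · rw [if_neg (by simpa using hai), zero_sub, abs_neg]
            split_ifs
            · exact ih1 _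
            · simp
          · have h0 : P.coeff (a - Finsupp.single j 1) = 0 := by
              apply ih2 _ i hi hi0
              simp [Ne.symm hij, hai]
            rw [if_pos hai, h0, ite_self, sub_zero]
            exact ih1 _
        · intro a l hl hl0 hal
          rw [Finset.mem_insert, not_or] at hl
          have hjl : j ≠ l := fun h => hl0 (by rw [h])
          have h1 : P.coeff (a - Finsupp.single j 1) = 0 := by
            apply ih2 _ l hl.2 hl0
            simp [hjl, hal]
          have h2 : P.coeff (a - Finsupp.single i 1) = 0 := by
            apply ih2 _ l hl.2 hl0
            simp [Ne.symm hl.1, hal]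
          rw [hc, mx, mx, h1, h2]
          simp

lemma gform_coeff (m : ℕ) (j : Fin (m + 1)) (k : ℕ) (a b : Fin m →₀ ℕ) :
    |(MvPolynomial.monomial b 1 * gform ℤ m j k).coeff a| ≤ (m.choose k : ℤ) := by
  have h : ∀ a, |(gform ℤ m j k).coeff a| ≤ (m.choose k : ℤ) := by
    intro a
    rw [gform, MvPolynomial.coeff_sum]
    refine (Finset.abs_sum_le_sum_abs _ _).trans ?_
    refine (Finset.sum_le_sum fun S _ => (qprod_coeff m j S).1 a).trans ?_
    simp
  rw [MvPolynomial.coeff_monomial_mul']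
  split_ifs
  · rw [one_mul]; exact h _
  · simp

end forms

section linalg

lemma exists_minor {ρ c : Type} [Fintype c] [DecidableEq c] (M : Matrix ρ c ℤ)
    (hspan : Submodule.span ℂ (Set.range fun r => fun j => (M r j : ℂ)) = ⊤) :
    ∃ f : c → ρ, Function.Injective f ∧ (M.submatrix f id).det ≠ 0 := by
  obtain ⟨κ, a, ha, hsp, hli⟩ := exists_linearIndependent' ℂ (fun r => fun j => (M r j : ℂ))
  let B := Module.Basis.mk hli (by rw [hsp, hspan])
  let e : c ≃ κ := (Pi.basisFun ℂ c).indexEquiv B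
  refine ⟨a ∘ e, ha.comp e.injective, ?_⟩
  intro h0
  have h1 : LinearIndependent ℂ (((M.submatrix (a ∘ e) id).map (Int.castRingHom ℂ)).row) :=
    hli.comp e e.injective
  rw [Matrix.linearIndependent_rows_iff_isUnit, Matrix.isUnit_iff_isUnit_det] at h1
  have h2 := RingHom.map_det (Int.castRingHom ℂ) (M.submatrix (a ∘ e) id)
  rw [h0, map_zero] at h2
  rw [RingHom.mapMatrix_apply] at h2
  rw [← h2] at h1
  exact not_isUnit_zero h1

lemma dvd_minor {ρ c : Type} [Fintype c] [DecidableEq c] (M : Matrix ρ c ℤ) {K : Type} [Field K]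
    (p : ℕ) [CharP K p] (v : c → K) (hv : v ≠ 0) (h : ∀ r, ∑ j, (M r j : K) * v j = 0)
    (f : c → ρ) : (p : ℤ) ∣ (M.submatrix f id).det := by
  rw [← CharP.intCast_eq_zero_iff K p]
  have h2 := RingHom.map_det (Int.castRingHom K) (M.submatrix f id)
  change ((M.submatrix f id).det : K) = _ at h2
  rw [h2]
  apply Matrix.exists_mulVec_eq_zero_iff.1
  refine ⟨v, hv, ?_⟩
  ext i
  exact h (f i)

lemma abs_det_le {c : Type} [Fintype c] [DecidableEq c] (N : Matrix c c ℤ) (b : c → ℤ)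
    (h : ∀ i j, |N i j| ≤ b i) : |N.det| ≤ (Fintype.card c).factorial * ∏ i, b i := by
  rw [← Matrix.det_transpose, Matrix.det_apply]
  refine (Finset.abs_sum_le_sum_abs _ _).trans ?_
  have : ∀ σ ∈ (Finset.univ : Finset (Equiv.Perm c)),
      |Equiv.Perm.sign σ • ∏ i, N.transpose (σ i) i| ≤ ∏ i, b i := by
    intro σ _
    rw [Units.smul_def, smul_eq_mul, abs_mul]
    have hs : |((Equiv.Perm.sign σ : ℤˣ) : ℤ)| = 1 := by
      rcases Int.units_eq_one_or (Equiv.Perm.sign σ) with h | h <;> simp [h]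
    rw [hs, one_mul, Finset.abs_prod]
    exact Finset.prod_le_prod (fun _ _ => abs_nonneg _) fun i _ => h i _
  refine (Finset.sum_le_sum this).trans ?_
  simp [Fintype.card_perm]

/-- The monomials of degree `e` in `m` variables. -/
abbrev Mono (m e : ℕ) : Type :=
  {a : Fin m →₀ ℕ // a ∈ Finset.finsuppAntidiag (Finset.univ : Finset (Fin m)) e}

lemma mem_mono {m e : ℕ} {a : Fin m →₀ ℕ} :
    a ∈ Finset.finsuppAntidiag (Finset.univ : Finset (Fin m)) e ↔ a.degree = e := by
  simp [Finsupp.degree_eq_sum]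

lemma card_mono (m e : ℕ) (hm : 1 ≤ m) : Fintype.card (Mono m e) = (e + m - 1).choose (m - 1) := by
  rw [Fintype.card_coe, Finset.card_finsuppAntidiag_nat_eq_choose, Finset.card_univ,
    Fintype.card_fin, add_comm m e]
  rw [← Nat.choose_symm (by omega)]
  congr 1
  omega

/-- The rows of the Macaulay matrix. -/
abbrev Row (m d : ℕ) : Type := (i : Fin m) × Mono m (d - ((i : ℕ) + 1))

/-- The Macaulay matrix. -/
noncomputable def macM (m d : ℕ) (T : Fin m → Fin (m + 1)) : Matrix (Row m d) (Mono m d) ℤ :=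
  fun r c => (MvPolynomial.monomial r.2.1 1 * gform ℤ m (T r.1) ((r.1 : ℕ) + 1)).coeff c.1

lemma macM_cast {R : Type} [CommRing R] (m d : ℕ) (T : Fin m → Fin (m + 1)) (r : Row m d)
    (c : Mono m d) : (macM m d T r c : R) =
      (MvPolynomial.monomial r.2.1 1 * gform R m (T r.1) ((r.1 : ℕ) + 1)).coeff c.1 := by
  rw [← gform_map (Int.castRingHom R)]
  have : (MvPolynomial.monomial r.2.1 (1 : R)) =
      MvPolynomial.map (Int.castRingHom R) (MvPolynomial.monomial r.2.1 1) := by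
    simp [MvPolynomial.map_monomial]
  rw [this, ← map_mul, MvPolynomial.coeff_map]
  rfl

lemma eval_mono {K : Type} [Field K] (m d : ℕ) (h : MvPolynomial (Fin m) K)
    (hh : h.IsHomogeneous d) (x : Fin m → K) :
    MvPolynomial.eval x h = ∑ c : Mono m d, h.coeff c.1 * ∏ i, x i ^ c.1 i := by
  rw [MvPolynomial.eval_eq']
  rw [Finset.sum_coe_sort (Finset.finsuppAntidiag (Finset.univ : Finset (Fin m)) d)
    (fun c => h.coeff c * ∏ i, x i ^ c i)]
  apply Finset.sum_subset
  · intro a ha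
    rw [mem_mono]
    by_contra hne
    exact (MvPolynomial.mem_support_iff.1 ha) (hh.coeff_eq_zero hne)
  · intro a _ ha
    rw [MvPolynomial.notMem_support_iff.1 ha, zero_mul]

lemma macM_kernel {K : Type} [Field K] (m d : ℕ) (hd : m ≤ d) (T : Fin m → Fin (m + 1))
    (x : Fin m → K) (hx : x ≠ 0)
    (hz : ∀ i : Fin m, MvPolynomial.eval x (gform K m (T i) (i + 1)) = 0) :
    ∃ v : Mono m d → K, v ≠ 0 ∧ ∀ r, ∑ j, (macM m d T r j : K) * v j = 0 := by
  refine ⟨fun c => ∏ i, x i ^ c.1 i, ?_, ?_⟩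
  · obtain ⟨i, hi⟩ := Function.ne_iff.1 hx
    intro h0
    have h1 := congrFun h0 ⟨Finsupp.single i d, by rw [mem_mono]; simp⟩
    simp only [Pi.zero_apply, Finset.prod_eq_zero_iff] at h1
    obtain ⟨l, _, hl⟩ := h1
    by_cases hil : i = l
    · subst hil
      exact hi (eq_zero_of_pow_eq_zero hl)
    · rw [Finsupp.single_eq_of_ne (Ne.symm hil), pow_zero] at hl
      exact one_ne_zero hl
  · intro r
    have hr := mem_mono.1 r.2.2
    have hlt := r.1.2
    have hh : (MvPolynomial.monomial r.2.1 (1 : K) * gform K m (T r.1) ((r.1 : ℕ) + 1)).IsHomogeneous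
        d := by
      have := (isHomogeneous_monomial (1 : K) hr).mul (gform_homog K m (T r.1) ((r.1 : ℕ) + 1))
      rwa [Nat.sub_add_cancel (by omega)] at this
    have := eval_mono m d _ hh x
    rw [map_mul, hz, mul_zero] at this
    rw [this]
    exact Finset.sum_congr rfl fun c _ => by rw [macM_cast]

lemma macM_span (m d : ℕ) (T : Fin m → Fin (m + 1))
    (h : ∀ c : Mono m d, MvPolynomial.monomial c.1 (1 : ℂ) ∈
      Ideal.span (Set.range fun i : Fin m => gform ℂ m (T i) ((i : ℕ) + 1))) :
    Submodule.span ℂ (Set.range fun r => fun j => (macM m d T r j : ℂ)) = ⊤ := by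
  classical
  set W := Submodule.span ℂ (Set.range fun r => fun j => (macM m d T r j : ℂ)) with hW
  let L : MvPolynomial (Fin m) ℂ →ₗ[ℂ] (Mono m d → ℂ) :=
    LinearMap.pi fun c => MvPolynomial.lcoeff ℂ c.1
  have hL : ∀ f c, L f c = f.coeff c.1 := fun f c => rfl
  have key : ∀ f ∈ Ideal.span (Set.range fun i : Fin m => gform ℂ m (T i) ((i : ℕ) + 1)),
      L f ∈ W := by
    intro f hf
    have mono : ∀ (i : Fin m) (α : Fin m →₀ ℕ) (a : ℂ),
        L (MvPolynomial.monomial α a * gform ℂ m (T i) ((i : ℕ) + 1)) ∈ W := by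
      intro i α a
      by_cases hα : α.degree + ((i : ℕ) + 1) = d
      · have hα2 : α ∈ Finset.finsuppAntidiag (Finset.univ : Finset (Fin m))
            (d - ((i : ℕ) + 1)) := by
          rw [mem_mono]; omega
        have e1 : MvPolynomial.monomial α a = a • MvPolynomial.monomial α (1 : ℂ) := by
          rw [MvPolynomial.smul_monomial, smul_eq_mul, mul_one]
        rw [e1, smul_mul_assoc, map_smul]
        apply W.smul_mem
        apply Submodule.subset_span
        refine ⟨⟨i, ⟨α, hα2⟩⟩, ?_⟩
        ext c
        rw [hL]
        exact macM_cast m d T ⟨i, ⟨α, hα2⟩⟩ c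
      · have e0 : L (MvPolynomial.monomial α a * gform ℂ m (T i) ((i : ℕ) + 1)) = 0 := by
          ext c
          rw [hL, Pi.zero_apply]
          have hh := (isHomogeneous_monomial a (rfl : α.degree = α.degree)).mul
            (gform_homog ℂ m (T i) ((i : ℕ) + 1))
          apply hh.coeff_eq_zero
          rw [mem_mono.1 c.2]
          exact Ne.symm hα
        rw [e0]
        exact W.zero_mem
    obtain ⟨q, rfl⟩ := (Ideal.mem_span_range_iff_exists_fun).1 hf
    rw [map_sum]
    refine W.sum_mem fun i _ => ?_
    rw [MvPolynomial.as_sum (q i), Finset.sum_mul, map_sum]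
    exact W.sum_mem fun α _ => mono i α _
  rw [eq_top_iff, ← (Pi.basisFun ℂ (Mono m d)).span_eq, Submodule.span_le]
  rintro _ ⟨c, rfl⟩
  have h1 := key _ (h c)
  have e2 : L (MvPolynomial.monomial c.1 1) = Pi.basisFun ℂ (Mono m d) c := by
    ext c'
    rw [hL, MvPolynomial.coeff_monomial, Pi.basisFun_apply, Pi.single_apply]
    by_cases hcc : c' = c
    · subst hcc; simp
    · rw [if_neg hcc, if_neg (fun h => hcc (Subtype.ext h.symm))]
  rw [← e2]
  exact h1

end linalg
section combi

lemma sorted_drop_prod : ∀ (L : List ℕ) (_ : L.Pairwise (· ≤ ·)) (s : Multiset ℕ) (_ : s ≤ (L : Multiset ℕ)),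
    s.prod ≤ (L.drop (L.length - s.card)).prod := by
  intro L
  induction L with
  | nil =>
    intro _ s hs
    have : s = 0 := by simpa using hs
    subst this
    simp
  | cons a L ih =>
    intro hL s hs
    rw [List.pairwise_cons] at hL
    have hcard := Multiset.card_le_card hs
    rw [Multiset.coe_card, List.length_cons] at hcard
    by_cases hc : s.card = L.length + 1
    · have : s = ((a :: L : List ℕ) : Multiset ℕ) :=
        Multiset.eq_of_le_of_card_le hs (by simp [hc])
      rw [this]
      simp
    have hlen : (a :: L).length - s.card = (L.length - s.card) + 1 := by
      simp; omega
    rw [hlen, List.drop_succ_cons]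
    by_cases hsL : s ≤ (L : Multiset ℕ)
    · exact ih hL.2 s hsL
    have ha : a ∈ s := by
      by_contra ha
      exact hsL ((Multiset.le_cons_of_notMem ha).1 (by simpa using hs))
    obtain ⟨t, rfl⟩ := Multiset.exists_cons_of_mem ha
    have ht : t ≤ (L : Multiset ℕ) := by
      rw [← Multiset.cons_coe] at hs
      exact (Multiset.cons_le_cons_iff a).1 hs
    obtain ⟨u, hu⟩ := Multiset.le_iff_exists_add.1 ht
    have hucard : 0 < u.card := by
      have := congrArg Multiset.card hu
      simp at this hc hcard
      omega
    obtain ⟨b, hb⟩ := Multiset.card_pos_iff_exists_mem.1 hucard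
    have hbL : b ∈ L := by
      rw [← Multiset.mem_coe, hu]
      exact Multiset.mem_add.2 (Or.inr hb)
    have h2 : b ::ₘ t ≤ (L : Multiset ℕ) := by
      obtain ⟨w, rfl⟩ := Multiset.exists_cons_of_mem hb
      rw [hu, Multiset.le_iff_exists_add]
      exact ⟨w, by simp⟩
    have h3 := ih hL.2 _ h2
    rw [Multiset.card_cons] at h3 ⊢
    refine le_trans ?_ h3
    rw [Multiset.prod_cons, Multiset.prod_cons]
    exact Nat.mul_le_mul_right _ (hL.1 b hbL)

end combi

section assembly

lemma casasMultiset_eq (m : ℕ) (hm : 1 ≤ m) : casasMultiset (m + 1) =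
    (Finset.univ : Finset (Row m (casasD (m + 1)))).val.map
      fun r => ((r.1 : ℕ) + 1 + m - 1).choose (m - 1) := by
  have h1 : (Finset.Icc 1 (m + 1 - 1)).val =
      (Finset.univ : Finset (Fin m)).val.map fun i : Fin m => (i : ℕ) + 1 := by
    have hinj : Function.Injective fun i : Fin m => (i : ℕ) + 1 :=
      fun a b h => Fin.ext (Nat.succ.inj h)
    have : Finset.Icc 1 (m + 1 - 1) = (Finset.univ : Finset (Fin m)).map
        ⟨fun i : Fin m => (i : ℕ) + 1, hinj⟩ := by
      ext k
      simp only [Finset.mem_Icc, Finset.mem_map, Finset.mem_univ, true_and,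
        Function.Embedding.coeFn_mk]
      constructor
      · rintro ⟨h1, h2⟩
        exact ⟨⟨k - 1, by omega⟩, by change k - 1 + 1 = k; omega⟩
      · rintro ⟨i, rfl⟩
        have := i.2
        omega
    rw [this]
    rfl
  unfold casasMultiset
  rw [h1, Multiset.bind_map]
  have h2 : (Finset.univ : Finset (Row m (casasD (m + 1)))).val =
      (Finset.univ : Finset (Fin m)).val.sigma
        fun i => (Finset.univ : Finset (Mono m (casasD (m + 1) - ((i : ℕ) + 1)))).val := rfl
  rw [h2, Multiset.sigma, Multiset.map_bind]
  apply Multiset.bind_congr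
  intro i _
  rw [Multiset.map_map]
  have h3 : ((fun r : Row m (casasD (m + 1)) => ((r.1 : ℕ) + 1 + m - 1).choose (m - 1)) ∘
      Sigma.mk i) = fun _ => ((i : ℕ) + 1 + m - 1).choose (m - 1) := rfl
  rw [h3, Multiset.map_const']
  have h4 := card_mono m (casasD (m + 1) - ((i : ℕ) + 1)) hm
  rw [← Finset.card_univ] at h4
  rw [← Finset.card_def, h4]
  rfl

lemma casasMultiset_card (n : ℕ) : (casasMultiset n).card = casasDD n := by
  unfold casasMultiset casasDD
  rw [Multiset.card_bind]
  simp only [Function.comp_def, Multiset.card_replicate]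
  rfl

lemma two_casasD (m : ℕ) (hm : 2 ≤ m) : 2 * casasD (m + 1) + m = m * m + 2 := by
  obtain ⟨k, rfl⟩ := Nat.exists_eq_add_of_le hm
  have h : (2 + k + 1) ^ 2 - 3 * (2 + k + 1) + 4 = 4 + k * (k + 3) := by
    have : (2 + k + 1) ^ 2 = 3 * (2 + k + 1) + k * (k + 3) := by ring
    rw [this]; omega
  have h2 : 2 ∣ k * (k + 3) := by
    rcases Nat.even_or_odd k with h | h
    · exact (even_iff_two_dvd.1 h).mul_right _
    · exact (even_iff_two_dvd.1 (h.add_odd (by decide))).mul_left _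
  unfold casasD
  rw [h]
  obtain ⟨c, hc⟩ := h2
  have : (2 + k) * (2 + k) = 4 + k + k * (k + 3) := by ring
  rw [this, hc]
  omega

lemma casasC_eq (m : ℕ) (hm : 1 ≤ m) : Fintype.card (Mono m (casasD (m + 1))) = casasC (m + 1) := by
  rw [card_mono m _ hm]
  unfold casasC
  rcases Nat.lt_or_ge m 2 with h | h
  · have : m = 1 := by omega
    subst this
    simp
  · have h1 := two_casasD m h
    have h2 : ((m + 1) ^ 2 - (m + 1)) = m * m + m := by
      have : (m + 1) ^ 2 = m * m + m + (m + 1) := by ring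
      rw [this]; omega
    rw [h2]
    congr 1
    omega

lemma le_casasD (m : ℕ) (hm : 1 ≤ m) : m ≤ casasD (m + 1) := by
  rcases Nat.lt_or_ge m 2 with h | h
  · have : m = 1 := by omega
    subst this
    decide
  · have h1 := two_casasD m h
    obtain ⟨k, rfl⟩ := Nat.exists_eq_add_of_le h
    nlinarith [sq_nonneg k, Nat.zero_le k]

lemma sum_lt_casasD (m : ℕ) (hm : 1 ≤ m) :
    ∑ i : Fin m, ((i : ℕ) + 1) < casasD (m + 1) + m := by
  rw [Fin.sum_univ_eq_sum_range (fun i => i + 1) m]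
  have hs : (∑ i ∈ Finset.range m, (i + 1)) * 2 = m * m + m := by
    clear hm
    induction m with
    | zero => rfl
    | succ k ih => rw [Finset.sum_range_succ, add_mul, ih]; ring
  rcases Nat.lt_or_ge m 2 with h | h
  · have : m = 1 := by omega
    subst this
    decide
  · have h1 := two_casasD m h
    omega

lemma mem_radical_of_zero (m : ℕ) (g : Fin m → MvPolynomial (Fin m) ℂ)
    (h : ∀ x : Fin m → ℂ, (∀ i, MvPolynomial.eval x (g i) = 0) → x = 0) (i : Fin m) :
    MvPolynomial.X i ∈ (Ideal.span (Set.range g)).radical := by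
  rw [← MvPolynomial.vanishingIdeal_zeroLocus_eq_radical (K := ℂ)]
  rw [MvPolynomial.mem_vanishingIdeal_iff]
  intro x hx
  have : x = 0 := by
    apply h
    intro j
    have := hx (g j) (Ideal.subset_span ⟨j, rfl⟩)
    simpa using this
  subst this
  simp

lemma exists_good_minor (m : ℕ) (hm : 1 ≤ m)
    (h0 : ∀ f : Polynomial ℂ, IsCasasAlvero (m + 1) f →
        ∃ b : ℂ, f = (Polynomial.X - Polynomial.C b) ^ (m + 1)) (T : Fin m → Fin (m + 1)) :
    ∃ f : Mono m (casasD (m + 1)) → Row m (casasD (m + 1)), Function.Injective f ∧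
      ((macM m (casasD (m + 1)) T).submatrix f id).det ≠ 0 := by
  apply exists_minor
  apply macM_span
  intro c
  refine (macaulay_aux m (fun i : Fin m => gform ℂ m (T i) ((i : ℕ) + 1))
    (fun i => (i : ℕ) + 1) (fun i => gform_homog _ _ _ _) (fun i => Nat.succ_pos _) ?_).2
    (casasD (m + 1)) _ (isHomogeneous_monomial _ (mem_mono.1 c.2)) (sum_lt_casasD m hm)
  apply mem_radical_of_zero
  intro x hx
  exact zero_of_ca m h0 T x hx

lemma choose_le_aux (m k : ℕ) (hm : 1 ≤ m) (hk : 1 ≤ k) :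
    m.choose k ≤ (k + m - 1).choose (m - 1) := by
  have h : (k + m - 1).choose (m - 1) = (k + m - 1).choose k := by
    rw [← Nat.choose_symm (by omega)]
    congr 1
    omega
  rw [h]
  exact Nat.choose_le_choose k (by omega)

lemma minor_bound (m : ℕ) (hm : 1 ≤ m) (T : Fin m → Fin (m + 1))
    (f : Mono m (casasD (m + 1)) → Row m (casasD (m + 1))) (hf : Function.Injective f) :
    |((macM m (casasD (m + 1)) T).submatrix f id).det| ≤
      (((casasC (m + 1)).factorial *
      (((casasMultiset (m + 1)).sort (· ≤ ·)).drop
        (casasDD (m + 1) - casasC (m + 1))).prod : ℕ) : ℤ) := by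
  refine (abs_det_le _ (fun c => (((((f c).1 : ℕ) + 1 + m - 1).choose (m - 1) : ℕ) : ℤ))
    ?_).trans ?_
  · intro c c'
    refine (gform_coeff _ _ _ _ _).trans ?_
    exact_mod_cast choose_le_aux m _ hm (Nat.succ_pos _)
  · rw [casasC_eq m hm]
    rw [Nat.cast_mul, ← Nat.cast_prod]
    apply mul_le_mul_of_nonneg_left _ (by positivity)
    have h := sorted_drop_prod ((casasMultiset (m + 1)).sort (· ≤ ·))
      (Multiset.pairwise_sort _ _)
      ((Finset.univ : Finset (Mono m (casasD (m + 1)))).val.map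
        fun c => ((((f c).1 : ℕ) + 1 + m - 1).choose (m - 1))) (by
        rw [Multiset.sort_eq, casasMultiset_eq m hm]
        have : (fun c => ((((f c).1 : ℕ) + 1 + m - 1).choose (m - 1))) =
          (fun r : Row m (casasD (m + 1)) => ((r.1 : ℕ) + 1 + m - 1).choose (m - 1)) ∘ f := rfl
        rw [this, ← Multiset.map_map]
        apply Multiset.map_le_map
        rw [Multiset.le_iff_subset (Multiset.Nodup.map hf Finset.univ.nodup)]
        intro r _
        exact Finset.mem_univ r)
    rw [Multiset.length_sort, Multiset.card_map, casasMultiset_card, ← Finset.card_def,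
      Finset.card_univ, casasC_eq m hm] at h
    exact_mod_cast h

lemma three_le_casasC (m : ℕ) (hm : 2 ≤ m) : 3 ≤ casasC (m + 1) := by
  rw [← casasC_eq m (by omega), card_mono m _ (by omega)]
  have h1 := le_casasD m (by omega)
  calc 3 = Nat.choose 3 2 := by decide
    _ ≤ (m + 1).choose 2 := Nat.choose_le_choose _ (by omega)
    _ = (m + 1).choose (m - 1) := by
      rw [← Nat.choose_symm (by omega)]
      congr 1
    _ ≤ (casasD (m + 1) + m - 1).choose (m - 1) := Nat.choose_le_choose _ (by omega)

end assembly

/-- **Remark (improved bound).** If the Casas–Alvero conjecture holds in degree `n` in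
characteristic `0`, then every bad prime `p` for `n` satisfies `p < C! · ∏_{k=D-C+1}^{D} b_k`,
where `b_1 ≤ … ≤ b_D` is the nondecreasing enumeration of the above multiset (so the product is
over the `C` largest entries, i.e. over the last `C` entries of the sorted list). -/
theorem badPrime_lt_improved_bound (n : ℕ) (hn : 2 ≤ n)
    (hCA0 : ∀ (K : Type) [Field K] [IsAlgClosed K] [CharP K 0],
      ∀ f : Polynomial K, IsCasasAlvero n f →
        ∃ b : K, f = (Polynomial.X - Polynomial.C b) ^ n)
    (p : ℕ) (hp : IsBadPrime n p) :
    p < (casasC n).factorial *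
      (((casasMultiset n).sort (· ≤ ·)).drop (casasDD n - casasC n)).prod := by
  obtain ⟨m, rfl⟩ : ∃ m, n = m + 1 := ⟨n - 1, by omega⟩
  have hm : 1 ≤ m := by omega
  obtain ⟨hpp, K, _, _, _, f, hf, hnf⟩ := hp
  obtain ⟨T, x, hx, hz⟩ := ca_to_zero m f hf hnf
  obtain ⟨F, hF, hdet⟩ := exists_good_minor m hm (hCA0 ℂ) T
  obtain ⟨v, hv, hker⟩ := macM_kernel m (casasD (m + 1)) (le_casasD m hm) T x hx hz
  have hdvd := dvd_minor (macM m (casasD (m + 1)) T) p v hv hker F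
  have hle := Int.le_of_dvd (abs_pos.2 hdet) ((dvd_abs _ _).2 hdvd)
  have hle2 := hle.trans (minor_bound m hm T F hF)
  have hle3 : p ≤ (casasC (m + 1)).factorial *
      (((casasMultiset (m + 1)).sort (· ≤ ·)).drop
        (casasDD (m + 1) - casasC (m + 1))).prod := by exact_mod_cast hle2
  refine lt_of_le_of_ne hle3 ?_
  intro heq
  rcases Nat.lt_or_ge m 2 with h | h
  · have : m = 1 := by omega
    subst this
    have e : (casasC (1 + 1)).factorial *
      (((casasMultiset (1 + 1)).sort (· ≤ ·)).drop
        (casasDD (1 + 1) - casasC (1 + 1))).prod = 1 := by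
      have e1 : casasC (1 + 1) = 1 := by decide
      have e2 : casasDD (1 + 1) = 1 := by decide
      have e3 : casasMultiset (1 + 1) = {1} := by decide
      rw [e1, e2, e3]
      simp
    rw [e] at heq
    exact hpp.one_lt.ne' heq
  · have h6 : 6 ∣ p := by
      rw [heq]
      exact Dvd.dvd.mul_right (Nat.factorial_dvd_factorial (three_le_casasC m h)) _
    have h2 := (Nat.prime_dvd_prime_iff_eq Nat.prime_two hpp).1 (dvd_trans (by norm_num) h6)
    rw [← h2] at h6
    exact absurd h6 (by norm_num)
end
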